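/- arXiv:0903.5352 — 4 statements merged into one kernel-verified Lean document; each statement's English description precedes it below -/
import Mathlib

section
/- Let k ≥ 1 be an integer and let G be a finite simple graph whose vertex set is partitioned into two sets A and B. If 2·e_G(A) + e_G(A,B) > (2k−2)·|A| + k·|B|, then G contains a path of order 2k or of order 2k+1 whose both endpoints lie in A. -/
/-- The list `l` is the vertex sequence of a path of `H` inside the vertex set `U`. -/
structure SimpleGraph.IsPathList {V : Type*} (H : SimpleGraph V) (U : Finset V) (l : List V) :
    Prop where
  isChain : l.IsChain H.Adj
  nodup : l.Nodup
  mem : ∀ v ∈ l, v ∈ U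

namespace SimpleGraph.IsPathList

variable {V : Type*} {H : SimpleGraph V} {U : Finset V} {l : List V}

theorem reverse (h : H.IsPathList U l) : H.IsPathList U l.reverse := by
  refine ⟨?_, List.nodup_reverse.2 h.nodup, fun v hv => h.mem v (List.mem_reverse.1 hv)⟩
  rw [List.isChain_reverse]
  exact h.isChain.imp fun _ _ hab => hab.symm

theorem tail (h : H.IsPathList U l) : H.IsPathList U l.tail :=
  ⟨h.isChain.tail, h.nodup.tail, fun v hv => h.mem v (List.mem_of_mem_tail hv)⟩

theorem length_le (h : H.IsPathList U l) : l.length ≤ U.card := by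
  classical
  rw [← List.toFinset_card_of_nodup h.nodup]
  exact Finset.card_le_card fun v hv => h.mem v (List.mem_toFinset.1 hv)

theorem exists_longest (H : SimpleGraph V) (U : Finset V) :
    ∃ l, H.IsPathList U l ∧ ∀ l', H.IsPathList U l' → l'.length ≤ l.length := by
  classical
  obtain ⟨l, hl, hlen⟩ := Nat.findGreatest_spec
    (P := fun n => ∃ l, H.IsPathList U l ∧ l.length = n) (Nat.zero_le U.card)
    ⟨[], ⟨by simp, by simp, by simp⟩, rfl⟩
  refine ⟨l, hl, fun l' hl' => ?_⟩
  rw [hlen]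
  exact Nat.le_findGreatest hl'.length_le ⟨l', hl', rfl⟩

/-- Every neighbour of the first vertex of a longest path lies on the path. -/
theorem mem_of_adj_head (h : H.IsPathList U l)
    (hmax : ∀ l', H.IsPathList U l' → l'.length ≤ l.length) {x v : V} (hx : l.head? = some x)
    (hv : v ∈ U) (hxv : H.Adj x v) : v ∈ l := by
  by_contra hvl
  have := hmax (v :: l) ⟨List.isChain_cons.2 ⟨by simpa [hx] using hxv.symm, h.isChain⟩,
    List.nodup_cons.2 ⟨hvl, h.nodup⟩, by simpa [hv] using h.mem⟩
  simp at this

/-- A longest path whose end degrees sum to at least its order can be rearranged to a cycle. -/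
theorem exists_cycle [DecidableRel H.Adj] (h : H.IsPathList U l)
    (hmax : ∀ l', H.IsPathList U l' → l'.length ≤ l.length) {x y : V} (hx : l.head? = some x)
    (hy : l.getLast? = some y)
    (hdeg : l.length ≤ (U.filter (H.Adj x)).card + (U.filter (H.Adj y)).card) :
    ∃ c, H.IsPathList U c ∧ c.Perm l ∧ c.head? = some x ∧ ∀ z ∈ c.getLast?, H.Adj z x := by
  classical
  have hpos : 0 < l.length := by
    rcases l with _ | _ <;> simp_all
  have hx0 : l[0] = x := by
    rw [List.head?_eq_getElem?, List.getElem?_eq_getElem hpos] at hx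
    simpa using hx
  have hyl : l[l.length - 1] = y := by
    rw [List.getLast?_eq_getElem?, List.getElem?_eq_getElem (by omega)] at hy
    simpa using hy
  let I := (Finset.range (l.length - 1)).filter fun i => ∃ v ∈ l[i + 1]?, H.Adj x v
  let J := (Finset.range (l.length - 1)).filter fun i => ∃ v ∈ l[i]?, H.Adj y v
  have hI : (U.filter (H.Adj x)).card ≤ I.card := by
    refine (Finset.card_le_card (t := I.image fun i => l[i + 1]?.getD x) fun v hv => ?_).trans
      Finset.card_image_le
    obtain ⟨hvU, hxv⟩ := Finset.mem_filter.1 hv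
    obtain ⟨j, hj, rfl⟩ := List.getElem_of_mem (h.mem_of_adj_head hmax hx hvU hxv)
    rcases j with _ | j
    · exact absurd hx0.symm hxv.ne
    · exact Finset.mem_image.2 ⟨j, Finset.mem_filter.2 ⟨Finset.mem_range.2 (by omega), l[j + 1],
        List.getElem?_eq_getElem hj, hxv⟩, by simp [hj]⟩
  have hJ : (U.filter (H.Adj y)).card ≤ J.card := by
    refine (Finset.card_le_card (t := J.image fun i => l[i]?.getD x) fun v hv => ?_).trans
      Finset.card_image_le
    obtain ⟨hvU, hyv⟩ := Finset.mem_filter.1 hv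
    have hvl : v ∈ l := List.mem_reverse.1 <|
      h.reverse.mem_of_adj_head (by simpa using hmax) (by simpa using hy) hvU hyv
    obtain ⟨j, hj, rfl⟩ := List.getElem_of_mem hvl
    have hne : j ≠ l.length - 1 := by
      rintro rfl
      exact hyv.ne hyl.symm
    exact Finset.mem_image.2 ⟨j, Finset.mem_filter.2 ⟨Finset.mem_range.2 (by omega), l[j],
        List.getElem?_eq_getElem hj, hyv⟩, by simp [hj]⟩
  obtain ⟨i, hi⟩ : (I ∩ J).Nonempty := by
    rw [← Finset.card_pos]
    have h1 := Finset.card_union_add_card_inter I J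
    have h2 : (I ∪ J).card ≤ l.length - 1 := by
      simpa using Finset.card_le_card (Finset.union_subset (Finset.filter_subset _ _)
        (Finset.filter_subset _ _) : I ∪ J ⊆ Finset.range (l.length - 1))
    omega
  simp only [I, J, Finset.mem_inter, Finset.mem_filter, Finset.mem_range] at hi
  obtain ⟨⟨hil, v, hv, hxv⟩, -, w, hw, hyw⟩ := hi
  obtain ⟨l₁, l₂, rfl, h₁⟩ : ∃ l₁ l₂, l = l₁ ++ l₂ ∧ l₁.length = i + 1 :=
    ⟨l.take (i + 1), l.drop (i + 1), by simp, by simp; omega⟩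
  have h₁' : l₁ ≠ [] := by rintro rfl; simp at h₁
  have h₂' : l₂ ≠ [] := by rintro rfl; simp at hil; omega
  have hw' : l₁.getLast? = some w := by
    rw [List.getLast?_eq_getElem?, h₁]
    rwa [List.getElem?_append_left (by omega)] at hw
  have hv' : l₂.head? = some v := by
    rw [List.head?_eq_getElem?]
    rw [List.getElem?_append_right (by omega)] at hv
    simpa [h₁] using hv
  have hy' : l₂.getLast? = some y := by
    rw [List.getLast?_append_of_ne_nil _ h₂'] at hy
    exact hy
  have hp : (l₁ ++ l₂.reverse).Perm (l₁ ++ l₂) := (List.reverse_perm l₂).append_left l₁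
  have hc := List.isChain_append.1 h.isChain
  refine ⟨l₁ ++ l₂.reverse, ⟨List.isChain_append.2 ⟨hc.1, ?_, ?_⟩, hp.nodup_iff.2 h.nodup,
    fun u hu => h.mem u (hp.mem_iff.1 hu)⟩, hp, ?_, ?_⟩
  · rw [List.isChain_reverse]
    exact hc.2.1.imp fun _ _ hab => hab.symm
  · simpa [hw', hy'] using hyw.symm
  · rwa [List.head?_append_of_ne_nil _ h₁'] at hx ⊢
  · rw [List.getLast?_append_of_ne_nil _ (by simpa using h₂')]
    simpa [hv'] using hxv.symm

/-- Rotating a cycle gives a path. -/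
theorem rotate {m₁ m₂ : List V} (h : H.IsPathList U (m₁ ++ m₂))
    (hcyc : ∀ z ∈ (m₁ ++ m₂).getLast?, ∀ x ∈ (m₁ ++ m₂).head?, H.Adj z x) :
    H.IsPathList U (m₂ ++ m₁) := by
  have hc := List.isChain_append.1 h.isChain
  have hp : (m₂ ++ m₁).Perm (m₁ ++ m₂) := List.perm_append_comm
  refine ⟨List.isChain_append.2 ⟨hc.2.1, hc.1, fun z hz x hx => hcyc z ?_ x ?_⟩,
    hp.nodup_iff.2 h.nodup, fun u hu => h.mem u (hp.mem_iff.1 hu)⟩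
  · rw [List.getLast?_append, Option.mem_def.1 hz]; rfl
  · rw [List.head?_append, Option.mem_def.1 hx]; rfl

/-- A cycle through the vertices of a longest path spans a component. -/
theorem mem_of_adj_of_cycle (h : H.IsPathList U l)
    (hmax : ∀ l', H.IsPathList U l' → l'.length ≤ l.length)
    (hcyc : ∀ z ∈ l.getLast?, ∀ x ∈ l.head?, H.Adj z x) {u v : V} (hu : u ∈ l) (hv : v ∈ U)
    (huv : H.Adj u v) : v ∈ l := by
  obtain ⟨m₁, m₂, rfl⟩ := List.append_of_mem hu
  have := (h.rotate hcyc).mem_of_adj_head (x := u) (v := v)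
    (fun l' hl' => by simpa [add_comm, add_left_comm, add_assoc] using hmax l' hl') (by simp) hv huv
  simp only [List.mem_append, List.mem_cons] at this ⊢
  tauto

/-- If every edge meets `A`, a path gets both of its ends in `A` by dropping its ends outside
`A`. -/
theorem length_le_of_forall_ends [DecidableEq V] {A : Finset V} {n : ℕ}
    (hA : ∀ u v, H.Adj u v → u ∈ A ∨ v ∈ A)
    (hn : ∀ l, H.IsPathList U l → (∀ a ∈ l.head?, a ∈ A) → (∀ a ∈ l.getLast?, a ∈ A) →
      l.length ≤ n) (h : H.IsPathList U l) {x y : V} (hx : l.head? = some x)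
    (hy : l.getLast? = some y) :
    l.length ≤ n + (if x ∈ A then 0 else 1) + (if y ∈ A then 0 else 1) := by
  have key : ∀ l, H.IsPathList U l → (∀ a ∈ l.getLast?, a ∈ A) → ∀ x, l.head? = some x →
      l.length ≤ n + (if x ∈ A then 0 else 1) := by
    intro l h hlast x hx
    split_ifs with hxA
    · exact hn l h (by simpa [hx] using hxA) hlast
    · rcases l with _ | ⟨z, t⟩
      · simp
      obtain rfl : z = x := by simpa using hx
      have hc := List.isChain_cons.1 h.isChain
      have := hn t h.tail (fun a ha => (hA _ _ (hc.1 a ha)).resolve_left hxA) (fun a ha =>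
        hlast a (by simp [List.getLast?_cons, Option.mem_def.1 ha]))
      simpa using this
  by_cases hyA : y ∈ A
  · simpa [hyA] using key l h (by simpa [hy] using hyA) x hx
  · simp only [hyA, if_false]
    obtain ⟨t, ht⟩ : ∃ t, l.reverse = y :: t := by
      rcases hl : l.reverse with _ | ⟨z, t⟩
      · simp_all
      · refine ⟨t, ?_⟩
        have : l.reverse.head? = some y := by simpa using hy
        simp_all
    obtain rfl : l = t.reverse ++ [y] := by
      rw [← List.reverse_reverse l, ht]; simp
    rcases eq_or_ne t [] with rfl | htne
    · simp
    have h' := h.reverse.tail.reverse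
    have hc := List.isChain_append.1 h.isChain
    simp only [List.reverse_append, List.reverse_singleton, List.reverse_reverse,
      List.singleton_append, List.tail_cons] at h'
    rw [List.head?_append_of_ne_nil _ (by simpa using htne)] at hx
    have := key _ h' (fun a ha => (hA _ _ (hc.2.2 a ha y (by simp))).resolve_right hyA) x hx
    simp only [List.length_append, List.length_singleton]
    omega

/-- If every edge meets `A`, a path with at least `2 * k` vertices and both ends in `A` has an
initial segment of order `2 * k` or `2 * k + 1` with both ends in `A`. -/
theorem exists_walk {A : Finset V} {k : ℕ} (hk : 1 ≤ k)
    (hA : ∀ u v, H.Adj u v → u ∈ A ∨ v ∈ A) (hl : H.IsPathList U l)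
    (hhead : ∀ a ∈ l.head?, a ∈ A) (hlast : ∀ a ∈ l.getLast?, a ∈ A) (hlen : 2 * k ≤ l.length) :
    ∃ (u v : V) (p : H.Walk u v), p.IsPath ∧ u ∈ A ∧ v ∈ A ∧
      (p.length + 1 = 2 * k ∨ p.length + 1 = 2 * k + 1) := by
  have key : ∀ n, n < l.length → (∀ a ∈ l[n]?, a ∈ A) →
      ∃ (u v : V) (p : H.Walk u v), p.IsPath ∧ u ∈ A ∧ v ∈ A ∧ p.length = n := by
    intro n hn hnA
    have hne : l.take (n + 1) ≠ [] := by
      rw [← List.length_pos_iff, List.length_take]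
      omega
    refine ⟨_, _, Walk.ofSupport (l.take (n + 1)) hne (hl.isChain.take _), ?_, ?_, ?_, ?_⟩
    · rw [Walk.isPath_def, Walk.support_ofSupport]
      exact hl.nodup.sublist (List.take_sublist _ _)
    · refine hhead _ ?_
      rw [List.head_take, Option.mem_def, List.head?_eq_some_head]
    · refine hnA _ ?_
      rw [List.getLast_eq_getElem]
      simp [hn]
    · rw [Walk.length_ofSupport, List.length_take]
      omega
  by_cases h : ∀ a ∈ l[2 * k - 1]?, a ∈ A
  · obtain ⟨u, v, p, hp, hu, hv, hpl⟩ := key (2 * k - 1) (by omega) h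
    exact ⟨u, v, p, hp, hu, hv, by omega⟩
  · have hlen' : 2 * k < l.length := by
      refine lt_of_le_of_ne hlen fun he => h ?_
      rwa [he, ← List.getLast?_eq_getElem?]
    obtain ⟨u, v, p, hp, hu, hv, hpl⟩ := key (2 * k) hlen' fun a ha => by
      have hadj := List.isChain_iff_getElem.1 hl.isChain (2 * k - 1) (by omega)
      have hsucc : 2 * k - 1 + 1 = 2 * k := by omega
      simp only [hsucc] at hadj
      rw [List.getElem?_eq_getElem hlen'] at ha
      rw [List.getElem?_eq_getElem (by omega)] at h
      obtain rfl : l[2 * k] = a := by simpa using ha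
      exact (hA _ _ hadj).resolve_left fun h' => h (by simpa using h')
    exact ⟨u, v, p, hp, hu, hv, by omega⟩

end SimpleGraph.IsPathList

/-- If no two consecutive terms of a list satisfy `p`, and the first one does not, then at most
half of the terms satisfy `p`. -/
theorem List.two_mul_countP_le_length {α : Type*} (p : α → Prop) [DecidablePred p] (l : List α)
    (hl : l.IsChain fun a b => ¬ (p a ∧ p b)) (hhead : ∀ x ∈ l.head?, ¬ p x) :
    2 * l.countP p ≤ l.length := by
  suffices H : ∀ l : List α, l.IsChain (fun a b => ¬ (p a ∧ p b)) →
      2 * l.countP p ≤ l.length + 1 ∧ ((∀ x ∈ l.head?, ¬ p x) → 2 * l.countP p ≤ l.length) from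
    (H l hl).2 hhead
  intro l hl
  induction l with
  | nil => simp
  | cons a t ih =>
    obtain ⟨h1, h2⟩ := List.isChain_cons.1 hl
    obtain ⟨i1, i2⟩ := ih h2
    by_cases ha : p a
    · have := i2 fun x hx hpx => h1 x hx ⟨ha, hpx⟩
      simp [ha]
      omega
    · simp [ha]
      omega

namespace SimpleGraph

variable {V : Type*} [DecidableEq V] {H : SimpleGraph V} [DecidableRel H.Adj]

theorem sum_card_filter_adj_le_erase (A U : Finset V) {v : V} (hv : v ∈ U) :
    ∑ a ∈ U ∩ A, (U.filter (H.Adj a)).card ≤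
      ∑ a ∈ U.erase v ∩ A, ((U.erase v).filter (H.Adj a)).card +
        (if v ∈ A then 2 else 1) * (U.filter (H.Adj v)).card := by
  have h1 : ∀ a ∈ U.erase v ∩ A, (U.filter (H.Adj a)).card ≤
      ((U.erase v).filter (H.Adj a)).card + if H.Adj v a then 1 else 0 := by
    intro a _
    rw [Finset.filter_erase]
    split_ifs with hva
    · exact Nat.sub_le_iff_le_add.1 Finset.pred_card_le_card_erase
    · rw [Finset.erase_eq_of_notMem (by simp [hv, H.adj_comm a v, hva])]
      omega
  have h2 : ∑ a ∈ U.erase v ∩ A, (if H.Adj v a then 1 else 0) ≤ (U.filter (H.Adj v)).card := by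
    rw [← Finset.card_filter]
    refine Finset.card_le_card (Finset.filter_subset_filter _ ?_)
    exact Finset.inter_subset_left.trans (Finset.erase_subset _ _)
  have h3 := Finset.sum_le_sum h1
  rw [Finset.sum_add_distrib] at h3
  rw [Finset.erase_inter] at h2 h3 ⊢
  split_ifs with hvA
  · rw [← Finset.add_sum_erase _ _ (Finset.mem_inter.2 ⟨hv, hvA⟩)]
    omega
  · have : (U ∩ A).erase v = U ∩ A := Finset.erase_eq_of_notMem (by simp [hvA])
    rw [this] at h2 h3 ⊢
    omega

theorem sum_card_filter_adj_le_of_card_le (A S : Finset V) {n : ℕ} (hS : S.card ≤ n + 1) :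
    ∑ a ∈ S ∩ A, (S.filter (H.Adj a)).card ≤ n * (S ∩ A).card := by
  rw [mul_comm, ← smul_eq_mul]
  refine Finset.sum_le_card_nsmul _ _ _ fun a ha => ?_
  have : (S.filter (H.Adj a)).card < S.card := by
    refine Finset.card_lt_card (Finset.filter_ssubset.2 ⟨a, (Finset.mem_inter.1 ha).1, ?_⟩)
    exact H.loopless.irrefl a
  omega

theorem sum_card_filter_adj_eq_of_closed (A : Finset V) {S U : Finset V} (hSU : S ⊆ U)
    (hS : ∀ u ∈ S, ∀ v ∈ U, H.Adj u v → v ∈ S) :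
    ∑ a ∈ U ∩ A, (U.filter (H.Adj a)).card =
      ∑ a ∈ S ∩ A, (S.filter (H.Adj a)).card +
        ∑ a ∈ (U \ S) ∩ A, ((U \ S).filter (H.Adj a)).card := by
  have hdisj : Disjoint (S ∩ A) ((U \ S) ∩ A) :=
    (Finset.disjoint_sdiff).mono Finset.inter_subset_left Finset.inter_subset_left
  have hU : U ∩ A = (S ∩ A) ∪ ((U \ S) ∩ A) := by
    rw [← Finset.union_inter_distrib_right, Finset.union_sdiff_of_subset hSU]
  rw [hU, Finset.sum_union hdisj]
  congr 1 <;> refine Finset.sum_congr rfl fun a ha => congrArg Finset.card ?_ <;> ext v <;>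
    simp only [Finset.mem_inter, Finset.mem_sdiff, Finset.mem_filter] at ha ⊢
  · exact ⟨fun h => ⟨hS a ha.1 v h.1 h.2, h.2⟩, fun h => ⟨hSU h.1, h.2⟩⟩
  · exact ⟨fun h => ⟨⟨h.1, fun hv => ha.1.2 (hS v hv a ha.1.1 h.2.symm)⟩, h.2⟩,
      fun h => ⟨h.1.1, h.2⟩⟩

/-- If every edge meets `A` and no long path has both ends in `A`, then a nonempty vertex set in
which all degrees are large contains a component with fewer than `2 * k` vertices. -/
theorem exists_closed_of_forall_le_degree {A U : Finset V} {k : ℕ}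
    (hA : ∀ u v, H.Adj u v → u ∈ A ∨ v ∈ A)
    (hn : ∀ l, H.IsPathList U l → (∀ a ∈ l.head?, a ∈ A) → (∀ a ∈ l.getLast?, a ∈ A) →
      l.length < 2 * k)
    (hU : U.Nonempty)
    (hdeg : ∀ v ∈ U, k + (if v ∈ A then 0 else 1) ≤ (U.filter (H.Adj v)).card) :
    ∃ S ⊆ U, S.Nonempty ∧ S.card < 2 * k ∧ ∀ u ∈ S, ∀ v ∈ U, H.Adj u v → v ∈ S := by
  obtain ⟨l, hl, hmax, hhead⟩ : ∃ l, H.IsPathList U l ∧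
      (∀ l', H.IsPathList U l' → l'.length ≤ l.length) ∧
      ((∀ a ∈ l.head?, a ∈ A) → ∀ a ∈ l.getLast?, a ∈ A) := by
    obtain ⟨l, hl, hmax⟩ := IsPathList.exists_longest H U
    by_cases h : ∀ a ∈ l.getLast?, a ∈ A
    · exact ⟨l, hl, hmax, fun _ => h⟩
    · exact ⟨l.reverse, hl.reverse, by simpa using hmax, fun h' => absurd (by simpa using h') h⟩
  have hne : l ≠ [] := by
    rintro rfl
    obtain ⟨u, hu⟩ := hU
    simpa using hmax [u] ⟨by simp, by simp, by simpa using hu⟩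
  obtain ⟨x, hx⟩ : ∃ x, l.head? = some x := ⟨_, List.head?_eq_some_head hne⟩
  obtain ⟨y, hy⟩ : ∃ y, l.getLast? = some y := ⟨_, List.getLast?_eq_some_getLast hne⟩
  have hxU : x ∈ U := hl.mem x (List.mem_of_head? hx)
  have hyU : y ∈ U := hl.mem y (List.mem_of_getLast? hy)
  have hlen := hl.length_le_of_forall_ends hA (n := 2 * k - 1)
    (fun l h h1 h2 => Nat.le_sub_one_of_lt (hn l h h1 h2)) hx hy
  have hk : 0 < 2 * k := hn [] ⟨by simp, by simp, by simp⟩ (by simp) (by simp)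
  have hdx := hdeg x hxU
  have hdy := hdeg y hyU
  obtain ⟨c, hc, hperm, hcx, hcyc⟩ := hl.exists_cycle hmax hx hy (by omega)
  have hmax' : ∀ l', H.IsPathList U l' → l'.length ≤ c.length := by
    rwa [hperm.length_eq]
  have hcyc' : ∀ z ∈ c.getLast?, ∀ x ∈ c.head?, H.Adj z x := by
    intro z hz x' hx'
    obtain rfl : x = x' := by simpa [hcx] using hx'
    exact hcyc z hz
  have hcard : c.toFinset.card = c.length := List.toFinset_card_of_nodup hc.nodup
  refine ⟨c.toFinset, fun v hv => hc.mem v (List.mem_toFinset.1 hv),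
    ⟨x, List.mem_toFinset.2 (List.mem_of_head? hcx)⟩, ?_, fun u hu v hv huv =>
    List.mem_toFinset.2 (hc.mem_of_adj_of_cycle hmax' hcyc' (List.mem_toFinset.1 hu) hv huv)⟩
  rw [hcard]
  by_contra! hlong
  have hxA : x ∉ A := fun hxA => by
    have := hn l hl (by simpa [hx] using hxA) (hhead (by simpa [hx] using hxA))
    rw [hperm.length_eq] at hlong
    omega
  have halt : c.IsChain fun a b => ¬ (a ∈ A ∧ b ∈ A) := by
    rw [List.isChain_iff_forall_rel_of_append_cons_cons]
    rintro a b m₁ m₂ rfl ⟨ha, hb⟩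
    rw [List.append_cons] at hc hcyc' hlong
    have := hn _ (hc.rotate hcyc') (by simpa using hb)
      (by rw [← List.append_assoc, List.getLast?_concat]; simpa using ha)
    simp only [List.length_append, List.length_cons] at this hlong
    omega
  have hcount := c.two_mul_countP_le_length (· ∈ A) halt (by simpa [hcx] using hxA)
  have hdc : (U.filter (H.Adj x)).card ≤ c.countP (· ∈ A) := by
    rw [List.countP_eq_length_filter, ← List.toFinset_card_of_nodup (hc.nodup.filter _)]
    refine Finset.card_le_card fun v hv => ?_
    obtain ⟨hvU, hxv⟩ := Finset.mem_filter.1 hv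
    simp only [List.mem_toFinset, List.mem_filter, decide_eq_true_eq]
    exact ⟨hc.mem_of_adj_head hmax' hcx hvU hxv, (hA x v hxv).resolve_left hxA⟩
  have := hperm.length_eq
  simp only [hxA, if_false] at hdx hlen
  split_ifs at hlen <;> omega

/-- If every edge meets `A` and no path with at least `2 * k` vertices has both ends in `A`, then
the degrees of the vertices of `A` have a small sum. -/
theorem sum_card_filter_adj_le {A : Finset V} {k : ℕ} (hk : 1 ≤ k)
    (hA : ∀ u v, H.Adj u v → u ∈ A ∨ v ∈ A)
    (U : Finset V)
    (hn : ∀ l, H.IsPathList U l → (∀ a ∈ l.head?, a ∈ A) → (∀ a ∈ l.getLast?, a ∈ A) →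
      l.length < 2 * k) :
    ∑ a ∈ U ∩ A, (U.filter (H.Adj a)).card ≤ (2 * k - 2) * (U ∩ A).card + k * (U \ A).card := by
  induction U using Finset.strongInduction with
  | H U ih =>
  have ih' : ∀ T ⊂ U, ∑ a ∈ T ∩ A, (T.filter (H.Adj a)).card ≤
      (2 * k - 2) * (T ∩ A).card + k * (T \ A).card := fun T hT =>
    ih T hT fun l hl => hn l ⟨hl.isChain, hl.nodup, fun v hv => hT.1 (hl.mem v hv)⟩
  rcases U.eq_empty_or_nonempty with rfl | hU
  · simp
  by_cases hdeg : ∀ v ∈ U, k + (if v ∈ A then 0 else 1) ≤ (U.filter (H.Adj v)).card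
  · obtain ⟨S, hSU, hSne, hScard, hS⟩ := exists_closed_of_forall_le_degree hA hn hU hdeg
    have h1 := ih' _ (Finset.sdiff_ssubset hSU hSne)
    have h2 := sum_card_filter_adj_le_of_card_le (H := H) A S (n := 2 * k - 2) (by omega)
    have h3 : (S ∩ A).card + ((U \ S) ∩ A).card = (U ∩ A).card := by
      rw [← Finset.card_union_of_disjoint ((Finset.disjoint_sdiff).mono Finset.inter_subset_left
        Finset.inter_subset_left), ← Finset.union_inter_distrib_right,
        Finset.union_sdiff_of_subset hSU]
    have h4 : ((U \ S) \ A).card ≤ (U \ A).card :=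
      Finset.card_le_card (Finset.sdiff_subset_sdiff Finset.sdiff_subset le_rfl)
    rw [sum_card_filter_adj_eq_of_closed A hSU hS, ← h3, mul_add]
    have := Nat.mul_le_mul_left k h4
    omega
  · push Not at hdeg
    obtain ⟨v, hv, hlt⟩ := hdeg
    have h1 := ih' _ (Finset.erase_ssubset hv)
    have h2 := sum_card_filter_adj_le_erase (H := H) A U hv
    rw [Finset.erase_inter, Finset.erase_sdiff_comm] at h1
    rw [Finset.erase_inter] at h2
    by_cases hvA : v ∈ A
    · have h3 : ((U ∩ A).erase v).card + 1 = (U ∩ A).card :=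
        Finset.card_erase_add_one (by simp [hv, hvA])
      rw [Finset.erase_eq_of_notMem (s := U \ A) (by simp [hvA])] at h1
      rw [← h3, mul_add]
      simp only [hvA, if_true] at hlt h2
      omega
    · have h3 : ((U \ A).erase v).card + 1 = (U \ A).card :=
        Finset.card_erase_add_one (by simp [hv, hvA])
      rw [Finset.erase_eq_of_notMem (s := U ∩ A) (by simp [hvA])] at h1 h2
      rw [← h3, mul_add]
      simp only [hvA, if_false] at hlt h2
      omega

/-- Twice the number of edges inside `A` plus the number of edges from `A` to `B` is at most the
sum of the degrees over `A`. -/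
theorem two_mul_card_edges_add_card_edges_le [Fintype V] (G : SimpleGraph V) [DecidableRel G.Adj]
    {A B : Finset V} (hdisj : Disjoint A B) :
    2 * (G.edgeFinset.filter (fun e => ∀ v ∈ e, v ∈ A)).card
        + (G.edgeFinset.filter (fun e => ∃ a ∈ A, ∃ b ∈ B, e = s(a, b))).card ≤
      ∑ a ∈ A, (Finset.univ.filter (G.Adj a)).card := by
  have hAA : 2 * (G.edgeFinset.filter (fun e => ∀ v ∈ e, v ∈ A)).card ≤
      ∑ a ∈ A, (A.filter (G.Adj a)).card := by
    let K : SimpleGraph V :=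
      { Adj u v := G.Adj u v ∧ u ∈ A ∧ v ∈ A
        symm := ⟨fun u v h => ⟨h.1.symm, h.2.2, h.2.1⟩⟩
        loopless := ⟨fun u h => h.1.ne rfl⟩ }
    have : DecidableRel K.Adj := fun u v =>
      inferInstanceAs (Decidable (G.Adj u v ∧ u ∈ A ∧ v ∈ A))
    have hK : G.edgeFinset.filter (fun e => ∀ v ∈ e, v ∈ A) = K.edgeFinset := by
      ext e
      induction e with
      | _ u v => simp [K]
    rw [hK, ← K.sum_degrees_eq_twice_card_edges]
    rw [← Finset.sum_subset (Finset.subset_univ A)]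
    · refine Finset.sum_le_sum fun a _ => ?_
      rw [← K.card_neighborFinset_eq_degree]
      refine Finset.card_le_card fun v hv => ?_
      have hv' : G.Adj a v ∧ a ∈ A ∧ v ∈ A := (K.mem_neighborFinset a v).1 hv
      exact Finset.mem_filter.2 ⟨hv'.2.2, hv'.1⟩
    · intro v _ hv
      rw [← K.card_neighborFinset_eq_degree, Finset.card_eq_zero]
      refine Finset.eq_empty_of_forall_notMem fun w hw => ?_
      have hw' : G.Adj v w ∧ v ∈ A ∧ w ∈ A := (K.mem_neighborFinset v w).1 hw
      exact hv hw'.2.1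
  have hAB : (G.edgeFinset.filter (fun e => ∃ a ∈ A, ∃ b ∈ B, e = s(a, b))).card ≤
      ∑ a ∈ A, (B.filter (G.Adj a)).card := by
    rw [← Finset.card_sigma]
    refine (Finset.card_le_card fun e he => ?_).trans
      (Finset.card_image_le (f := fun p : (_ : V) × V => s(p.1, p.2)))
    obtain ⟨he, a, ha, b, hb, rfl⟩ := Finset.mem_filter.1 he
    have hab : G.Adj a b := by simpa using he
    exact Finset.mem_image.2 ⟨⟨a, b⟩, by simp [ha, hb, hab], rfl⟩
  refine (Nat.add_le_add hAA hAB).trans ?_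
  rw [← Finset.sum_add_distrib]
  refine Finset.sum_le_sum fun a _ => ?_
  rw [← Finset.card_union_of_disjoint (Finset.disjoint_filter_filter hdisj)]
  refine Finset.card_le_card fun v hv => ?_
  simp only [Finset.mem_union, Finset.mem_filter, Finset.mem_univ, true_and] at hv ⊢
  tauto

end SimpleGraph

/-- Lemma 1, part (A). Let `k ≥ 1` and let the vertices of a graph `G`
be partitioned into two sets `A` and `B`. If `2·e_G(A) + e_G(A,B) > (2k−2)|A| + k|B|`,
then `G` contains a path of order `2k` or `2k+1` with both ends in `A`.
Here `e_G(A)` is the number of edges with both endpoints in `A` and `e_G(A,B)` is the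
number of edges joining `A` to `B`; the order of a path is its number of vertices,
i.e. `length + 1`. -/
theorem degree_powers_stmt_0 {V : Type*} [Fintype V] [DecidableEq V]
    (G : SimpleGraph V) [DecidableRel G.Adj] (k : ℕ) (hk : 1 ≤ k)
    (A B : Finset V) (hdisj : Disjoint A B) (hcover : A ∪ B = Finset.univ)
    (hineq : 2 * (G.edgeFinset.filter (fun e => ∀ v ∈ e, v ∈ A)).card
        + (G.edgeFinset.filter (fun e => ∃ a ∈ A, ∃ b ∈ B, e = s(a, b))).card
        > (2 * k - 2) * A.card + k * B.card) :
    ∃ (u v : V) (p : G.Walk u v), p.IsPath ∧ u ∈ A ∧ v ∈ A ∧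
      (p.length + 1 = 2 * k ∨ p.length + 1 = 2 * k + 1) := by
  let H : SimpleGraph V :=
    { Adj u v := G.Adj u v ∧ (u ∈ A ∨ v ∈ A)
      symm := ⟨fun u v h => ⟨h.1.symm, h.2.symm⟩⟩
      loopless := ⟨fun u h => h.1.ne rfl⟩ }
  have : DecidableRel H.Adj := fun u v => inferInstanceAs (Decidable (G.Adj u v ∧ (u ∈ A ∨ v ∈ A)))
  have hA : ∀ u v, H.Adj u v → u ∈ A ∨ v ∈ A := fun u v h => h.2
  by_contra hcon
  have hn : ∀ l, H.IsPathList Finset.univ l → (∀ a ∈ l.head?, a ∈ A) →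
      (∀ a ∈ l.getLast?, a ∈ A) → l.length < 2 * k := by
    intro l hl hhead hlast
    by_contra! hlen
    obtain ⟨u, v, p, hp, hu, hv, hpl⟩ := hl.exists_walk hk hA hhead hlast hlen
    have hHG : H ≤ G := fun _ _ h => h.1
    exact hcon ⟨u, v, p.mapLe hHG, hp.mapLe hHG, hu, hv, by simpa using hpl⟩
  have h1 := SimpleGraph.sum_card_filter_adj_le hk hA Finset.univ hn
  have h2 := G.two_mul_card_edges_add_card_edges_le hdisj
  have h3 : ∑ a ∈ A, (Finset.univ.filter (G.Adj a)).card =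
      ∑ a ∈ A, (Finset.univ.filter (H.Adj a)).card := by
    refine Finset.sum_congr rfl fun a ha => congrArg Finset.card (Finset.filter_congr fun v _ => ?_)
    exact ⟨fun h => ⟨h, Or.inl ha⟩, fun h => h.1⟩
  have hB : Finset.univ \ A = B := by
    rw [← hcover, Finset.union_sdiff_cancel_left hdisj]
  rw [Finset.univ_inter, hB] at h1
  omega
end

section
/- Let k ≥ 1 be an integer and let G be a finite simple graph whose vertex set is partitioned into two sets A and B. If 2·e_G(A) + e_G(A,B) > (2k−1)·|A| + k·|B|, then G contains a path of order 2k+1 whose both endpoints lie in A. -/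
/-- The first `m` values of `f` form a path of `G` inside `W`. -/
structure IsPathIn {V : Type*} (G : SimpleGraph V) (W : Finset V) (f : ℕ → V) (m : ℕ) : Prop where
  mem : ∀ i < m, f i ∈ W
  inj : ∀ i < m, ∀ j < m, f i = f j → i = j
  adj : ∀ i, i + 1 < m → G.Adj (f i) (f (i + 1))

/-- The first `m` values of `f` form a path of `G` inside `W` with both ends satisfying `a`. -/
structure IsEndedPathIn {V : Type*} (G : SimpleGraph V) (a : V → Prop) (W : Finset V)
    (f : ℕ → V) (m : ℕ) : Prop extends IsPathIn G W f m where
  pos : 0 < m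
  head : a (f 0)
  last : a (f (m - 1))

section Paths

variable {V : Type*} {G : SimpleGraph V} {W : Finset V} {f : ℕ → V} {m : ℕ}

theorem IsPathIn.shift (h : IsPathIn G W f m) (s n : ℕ) (hn : n + s ≤ m) :
    IsPathIn G W (fun i => f (i + s)) n where
  mem i hi := h.mem _ (by omega)
  inj i hi j hj e := by have := h.inj _ (by omega) _ (by omega) e; omega
  adj i hi := by
    have := h.adj (i + s) (by omega)
    rwa [show i + 1 + s = i + s + 1 by omega]

theorem IsPathIn.take (h : IsPathIn G W f m) (n : ℕ) (hn : n ≤ m) : IsPathIn G W f n where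
  mem i hi := h.mem _ (by omega)
  inj i hi j hj e := h.inj _ (by omega) _ (by omega) e
  adj i hi := h.adj i (by omega)

theorem IsPathIn.reverse (h : IsPathIn G W f m) : IsPathIn G W (fun i => f (m - 1 - i)) m where
  mem i hi := h.mem _ (by omega)
  inj i hi j hj e := by have := h.inj _ (by omega) _ (by omega) e; omega
  adj i hi := by
    have := h.adj (m - 1 - (i + 1)) (by omega)
    rw [show m - 1 - (i + 1) + 1 = m - 1 - i by omega] at this
    exact this.symm

theorem IsPathIn.cons (h : IsPathIn G W f m) {x : V} (hx : x ∈ W) (hoff : ∀ i < m, f i ≠ x)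
    (hadj : G.Adj x (f 0)) :
    IsPathIn G W (fun i => if i = 0 then x else f (i - 1)) (m + 1) where
  mem i hi := by
    split_ifs
    · exact hx
    · exact h.mem _ (by omega)
  inj i hi j hj e := by
    split_ifs at e with h1 h2 h2
    · omega
    · exact absurd e.symm (hoff _ (by omega))
    · exact absurd e (hoff _ (by omega))
    · have := h.inj _ (by omega) _ (by omega) e; omega
  adj i hi := by
    rcases i with _ | i
    · simpa using hadj
    · simpa using h.adj i (by omega)

/-- Rotation of a path along an edge from its first vertex. -/
theorem IsPathIn.rotate (h : IsPathIn G W f m) {s : ℕ} (hsm : s < m)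
    (hadj : G.Adj (f 0) (f s)) :
    IsPathIn G W (fun i => if i < s then f (s - 1 - i) else f i) m where
  mem i hi := by
    split_ifs
    · exact h.mem _ (by omega)
    · exact h.mem _ (by omega)
  inj i hi j hj e := by
    split_ifs at e with h1 h2 h2 <;>
    · have := h.inj _ (by omega) _ (by omega) e; omega
  adj i hi := by
    split_ifs with h1 h2 h2
    · have := h.adj (s - 1 - (i + 1)) (by omega)
      rw [show s - 1 - (i + 1) + 1 = s - 1 - i by omega] at this
      exact this.symm
    · rw [show s - 1 - i = 0 by omega, show i + 1 = s by omega]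
      exact hadj
    · omega
    · exact h.adj i hi

/-- Changing the starting point of a cycle. -/
theorem IsPathIn.cycle_shift (h : IsPathIn G W f m) (hadj : G.Adj (f (m - 1)) (f 0)) {s : ℕ}
    (hs : s < m) :
    IsPathIn G W (fun i => if i + s < m then f (i + s) else f (i + s - m)) m where
  mem i hi := by
    split_ifs
    · exact h.mem _ (by omega)
    · exact h.mem _ (by omega)
  inj i hi j hj e := by
    split_ifs at e with h1 h2 h2 <;>
    · have := h.inj _ (by omega) _ (by omega) e; omega
  adj i hi := by
    split_ifs with h1 h2 h2
    · have := h.adj (i + s) (by omega)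
      rwa [show i + 1 + s = i + s + 1 by omega]
    · rw [show i + s = m - 1 by omega, show i + 1 + s - m = 0 by omega]
      exact hadj
    · omega
    · have := h.adj (i + s - m) (by omega)
      rwa [show i + 1 + s - m = i + s - m + 1 by omega]

theorem IsEndedPathIn.reverse {a : V → Prop} (h : IsEndedPathIn G a W f m) :
    IsEndedPathIn G a W (fun i => f (m - 1 - i)) m where
  toIsPathIn := h.toIsPathIn.reverse
  pos := h.pos
  head := h.last
  last := by simpa using h.head

theorem IsPathIn.exists_walk [DecidableEq V] (n : ℕ) (h : IsPathIn G W f (n + 1)) :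
    ∃ p : G.Walk (f 0) (f n), p.IsPath ∧ p.length = n ∧ ∀ v ∈ p.support, ∃ i ≤ n, f i = v := by
  induction n with
  | zero => exact ⟨.nil, by simp⟩
  | succ n ih =>
    obtain ⟨p, hp, hl, hs⟩ := ih (h.take _ (by omega))
    refine ⟨p.concat (h.adj n (by omega)), hp.concat ?_ _, by simp [hl], ?_⟩
    · intro hmem
      obtain ⟨i, hi, e⟩ := hs _ hmem
      have := h.inj _ (by omega) _ (by omega) e
      omega
    · intro v hv
      rw [SimpleGraph.Walk.support_concat, List.mem_append] at hv
      rcases hv with hv | hv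
      · obtain ⟨i, hi, e⟩ := hs _ hv
        exact ⟨i, by omega, e⟩
      · exact ⟨n + 1, le_rfl, (by simpa using hv : v = f (n + 1)).symm⟩

end Paths

/-- A word without two consecutive `false` letters, starting and ending with `true`, in which
no two letters at distance `2 * k` are both `true`, has even length and alternates near its ends. -/
theorem even_and_alternating_of_word {c : ℕ → Prop} {m k : ℕ} (hkm : 2 * k < m)
    (h0 : c 0) (hl : c (m - 1)) (hbb : ∀ i, i + 1 < m → c i ∨ c (i + 1))
    (h : ∀ i, i + 2 * k < m → c i → ¬ c (i + 2 * k)) :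
    m % 2 = 0 ∧ ∀ i, i + 2 * k < m → (c i ↔ i % 2 = 0) ∧ (c (i + 2 * k) ↔ i % 2 = 1) := by
  have key : ∀ i, i + 2 * k < m → (c i ↔ i % 2 = 0) ∧ (c (i + 2 * k) ↔ i % 2 = 1) := by
    intro i
    induction i with
    | zero =>
      intro hi
      have := h 0 hi h0
      simpa [h0] using this
    | succ i ih =>
      intro hi
      obtain ⟨h1, h2⟩ := ih (by omega)
      have h3 := hbb i (by omega)
      have h4 := hbb (i + 2 * k) (by omega)
      have h5 := h (i + 1) hi
      rw [show i + 2 * k + 1 = i + 1 + 2 * k by omega] at h4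
      rcases Nat.mod_two_eq_zero_or_one i with h6 | h6
      · have h7 : (i + 1) % 2 = 1 := by omega
        rw [h6] at h1 h2
        rw [h7]
        simp only [iff_true, zero_ne_one, iff_false] at h1 h2
        tauto
      · have h7 : (i + 1) % 2 = 0 := by omega
        rw [h6] at h1 h2
        rw [h7]
        simp only [iff_true, one_ne_zero, iff_false] at h1 h2
        tauto
  refine ⟨?_, key⟩
  have h1 := (key (m - 1 - 2 * k) (by omega)).2
  rw [show m - 1 - 2 * k + 2 * k = m - 1 by omega] at h1
  have := h1.1 hl
  omega

theorem two_mul_card_le_of_no_consecutive {I T : Finset ℕ} (h : ∀ i ∈ I, i + 1 ∉ I) (h0 : I ⊆ T)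
    (h1 : ∀ i ∈ I, i + 1 ∈ T) : 2 * I.card ≤ T.card := by
  have hd : Disjoint I (I.image (· + 1)) := by
    rw [Finset.disjoint_right]
    intro x hx
    obtain ⟨i, hi, rfl⟩ := Finset.mem_image.1 hx
    exact h i hi
  have hc : (I.image (· + 1)).card = I.card :=
    Finset.card_image_of_injective _ (add_left_injective 1)
  have hu : I ∪ I.image (· + 1) ⊆ T :=
    Finset.union_subset h0 (Finset.image_subset_iff.2 h1)
  have := Finset.card_le_card hu
  rw [Finset.card_union_of_disjoint hd, hc] at this
  omega

section MaximalPaths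

variable {V : Type*} {G : SimpleGraph V} {a : V → Prop} {W : Finset V} {f : ℕ → V} {m k : ℕ}

theorem IsEndedPathIn.even_and_alternating (h : IsEndedPathIn G a W f m)
    (hno : ∀ g, ¬ IsEndedPathIn G a W g (2 * k + 1)) (hbb : ∀ u v, G.Adj u v → a u ∨ a v)
    (hkm : 2 * k < m) :
    m % 2 = 0 ∧
      ∀ i, i + 2 * k < m → (a (f i) ↔ i % 2 = 0) ∧ (a (f (i + 2 * k)) ↔ i % 2 = 1) := by
  refine even_and_alternating_of_word (c := fun i => a (f i)) hkm h.head h.last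
    (fun i hi => hbb _ _ (h.adj i hi)) fun i hi h1 h2 => hno _ ⟨h.shift i (2 * k + 1) (by omega),
      by omega, by simpa using h1, ?_⟩
  simpa [add_comm] using h2

theorem IsEndedPathIn.two_mul_add_two_le (h : IsEndedPathIn G a W f m)
    (hno : ∀ g, ¬ IsEndedPathIn G a W g (2 * k + 1)) (hbb : ∀ u v, G.Adj u v → a u ∨ a v)
    (hkm : 2 * k < m) : 2 * k + 2 ≤ m := by
  have := (h.even_and_alternating hno hbb hkm).1
  omega

/-- A vertex that lies off a maximum path and is adjacent to its first vertex has at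
most `k` neighbours in `a`. -/
theorem IsEndedPathIn.card_neighbors_le_of_off [DecidableEq V] [DecidableRel G.Adj]
    [DecidablePred a] (h : IsEndedPathIn G a W f m)
    (hmax : ∀ g n, IsEndedPathIn G a W g n → n ≤ m)
    (hno : ∀ g, ¬ IsEndedPathIn G a W g (2 * k + 1)) (hbb : ∀ u v, G.Adj u v → a u ∨ a v)
    {x : V} (hx : x ∈ W) (hoff : ∀ i < m, f i ≠ x) (hadj : G.Adj x (f 0)) :
    (W.filter fun u => a u ∧ G.Adj x u).card ≤ k := by
  have hcons := h.cons hx hoff hadj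
  have hpos := h.pos
  set I := (Finset.range m).filter fun i => a (f i) ∧ G.Adj x (f i) with hI
  have hcard : (W.filter fun u => a u ∧ G.Adj x u).card ≤ I.card := by
    refine le_trans (Finset.card_le_card ?_) (Finset.card_image_le (s := I) (f := f))
    intro y hy
    obtain ⟨hyW, hay, hxy⟩ := Finset.mem_filter.1 hy
    by_contra hyI
    have hyoff : ∀ i < m, f i ≠ y := by
      rintro i hi rfl
      exact hyI (Finset.mem_image_of_mem _ (by simp [hI, hi, hay, hxy]))
    have h2 := hcons.cons hyW (by
      intro i hi
      split_ifs
      · exact hxy.ne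
      · exact hyoff _ (by omega)) (by simpa using hxy.symm)
    have := hmax _ _ ⟨h2, by omega, by simpa using hay, by simpa [hpos.ne'] using h.last⟩
    omega
  -- the path obtained by inserting `x` in front and rotating
  have hrot : ∀ i ∈ I, IsPathIn G W
      (fun p => if p < i + 1 then (if i - p = 0 then x else f (i - p - 1)) else f (p - 1))
      (m + 1) := by
    intro i hi
    simp only [hI, Finset.mem_filter, Finset.mem_range] at hi
    have := hcons.rotate (s := i + 1) (by omega) (by simpa using hi.2.2)
    convert this using 2 with p
    grind
  have hprev : ∀ i, i + 1 ∈ I → ¬ a (f i) := by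
    intro i hi hai
    have := hmax _ _ ⟨hrot _ hi, by omega, by simpa using hai, ?_⟩
    · omega
    · simp only [hI, Finset.mem_filter, Finset.mem_range] at hi
      have := h.last
      grind
  have hprev2 : ∀ i, i + 2 ∈ I → IsEndedPathIn G a W
      (fun p => if p < i + 2 then (if i + 1 - p = 0 then x else f (i + 1 - p - 1)) else f p) m := by
    intro i hi
    have h1 := hprev _ hi
    have h2 := (hrot _ hi).shift 1 m le_rfl
    simp only [hI, Finset.mem_filter, Finset.mem_range] at hi
    have h3 := hbb _ _ (h.adj i (by omega))
    refine ⟨?_, hpos, ?_, ?_⟩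
    · convert h2 using 2 with p
      grind
    · simp
      tauto
    · have := h.last
      grind
  have hnc : ∀ i ∈ I, i + 1 ∉ I := by
    intro i hi hi1
    simp only [hI, Finset.mem_filter, Finset.mem_range] at hi
    exact hprev _ hi1 hi.2.1
  refine hcard.trans ?_
  by_cases hkm : m ≤ 2 * k
  · have : 2 * I.card ≤ (Finset.range (m + 1)).card :=
      two_mul_card_le_of_no_consecutive hnc (fun i hi => by
        simp only [hI, Finset.mem_filter, Finset.mem_range] at hi ⊢; omega) (fun i hi => by
        simp only [hI, Finset.mem_filter, Finset.mem_range] at hi ⊢; omega)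
    rw [Finset.card_range] at this
    omega
  push Not at hkm
  obtain ⟨hev, halt⟩ := h.even_and_alternating hno hbb hkm
  obtain ⟨t, ht, hat, hat1⟩ : ∃ t, t + 1 < m ∧ a (f t) ∧ a (f (t + 1)) := by
    by_contra! hcon
    have : ∀ i < m, (a (f i) ↔ i % 2 = 0) := by
      intro i
      induction i with
      | zero => simp [h.head]
      | succ i ih =>
        intro hi
        have h1 := ih (by omega)
        have h2 := hcon i hi
        have h3 := hbb _ _ (h.adj i hi)
        rcases Nat.mod_two_eq_zero_or_one i with h6 | h6
        · have h7 : (i + 1) % 2 = 1 := by omega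
          simp_all
        · have h7 : (i + 1) % 2 = 0 := by omega
          simp_all
    have := (this (m - 1) (by omega)).1 h.last
    omega
  have htk : t + 1 ≤ 2 * k := by
    by_contra hcon
    have h1 := (halt (t - 2 * k) (by omega)).2
    have h2 := (halt (t + 1 - 2 * k) (by omega)).2
    rw [show t - 2 * k + 2 * k = t by omega] at h1
    rw [show t + 1 - 2 * k + 2 * k = t + 1 by omega] at h2
    have := h1.1 hat
    have := h2.1 hat1
    omega
  have hgap : ∀ i ∈ I, t + 1 ≤ i → i + 2 * k ≤ t + 1 + m → False := by
    intro i hi h1 h2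
    rcases Nat.lt_or_ge i (t + 3) with h3 | h3
    · obtain rfl | rfl : i = t + 1 ∨ i = t + 2 := by omega
      · exact hprev _ hi hat
      · exact hprev _ hi hat1
    · obtain ⟨s, rfl⟩ : ∃ s, i = s + 2 := ⟨i - 2, by omega⟩
      obtain ⟨-, h4⟩ := (hprev2 _ hi).even_and_alternating hno hbb hkm
      have h5 := (h4 (s - t) (by omega)).1
      have h6 := (h4 (s - t - 1) (by omega)).1
      rw [if_pos (by omega), if_neg (by omega), show s + 1 - (s - t) - 1 = t by omega] at h5
      rw [if_pos (by omega), if_neg (by omega),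
        show s + 1 - (s - t - 1) - 1 = t + 1 by omega] at h6
      have := h5.1 hat
      have := h6.1 hat1
      omega
  have : 2 * I.card ≤ (Finset.range (m + 1) \ Finset.Ico (t + 2) (t + 2 + (m - 2 * k))).card := by
    refine two_mul_card_le_of_no_consecutive hnc (fun i hi => ?_) (fun i hi => ?_) <;>
    · have : ¬ (t + 1 ≤ i ∧ i + 2 * k ≤ t + 1 + m) := fun h' => hgap i hi h'.1 h'.2
      simp only [hI, Finset.mem_filter, Finset.mem_range, Finset.mem_sdiff, Finset.mem_Ico]
        at hi ⊢
      omega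
  rw [Finset.card_sdiff_of_subset (by
    intro i
    simp only [Finset.mem_range, Finset.mem_Ico]
    omega), Finset.card_range, Nat.card_Ico] at this
  omega

/-- If all neighbours of the first vertex of a path of order greater than `2 * k` with ends in `a`
lie on the path, then this vertex has small weighted degree. -/
theorem IsEndedPathIn.weighted_degree_lt [DecidableEq V] [DecidableRel G.Adj]
    [DecidablePred a] (h : IsEndedPathIn G a W f m)
    (hno : ∀ g, ¬ IsEndedPathIn G a W g (2 * k + 1)) (hbb : ∀ u v, G.Adj u v → a u ∨ a v)
    (hkm : 2 * k < m) (hon : ∀ x ∈ W, G.Adj (f 0) x → ∃ i < m, f i = x) :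
    2 * (W.filter fun u => a u ∧ G.Adj (f 0) u).card +
      (W.filter fun u => ¬ a u ∧ G.Adj (f 0) u).card < 2 * k := by
  have hm2 := h.two_mul_add_two_le hno hbb hkm
  obtain ⟨hev, halt⟩ := h.even_and_alternating hno hbb hkm
  have second : ∀ g, IsEndedPathIn G a W g m → ¬ a (g 1) := by
    intro g hg
    have := ((hg.even_and_alternating hno hbb hkm).2 1 (by omega)).1
    simp [this]
  have hprev : ∀ i, i + 1 < m → G.Adj (f 0) (f (i + 1)) → a (f i) := by
    intro i hi hadj
    by_contra hai
    rcases i with _ | i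
    · exact hai h.head
    have h1 := (h.rotate hi hadj).shift 1 (m - 1) (by omega)
    have h3 := hbb _ _ (h.adj i (by omega))
    have h4 : IsEndedPathIn G a W _ (m - 1) := ⟨h1, by omega, by simp; tauto, by
      have := h.last
      grind⟩
    have := (h4.even_and_alternating hno hbb (by omega)).1
    omega
  have hprev2 : ∀ i, i + 2 < m → G.Adj (f 0) (f (i + 2)) → ¬ a (f i) := by
    intro i hi hadj
    have h1 := second _ ⟨h.rotate hi hadj, h.pos, by simpa using hprev _ hi hadj, by
      have := h.last
      grind⟩
    simpa using h1
  have hpen : ¬ a (f (m - 2)) := by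
    have := second _ h.reverse
    rwa [show m - 1 - 1 = m - 2 by omega] at this
  set JA := (Finset.range m).filter fun i => a (f i) ∧ G.Adj (f 0) (f i) with hJA
  set JB := (Finset.range m).filter fun i => ¬ a (f i) ∧ G.Adj (f 0) (f i) with hJB
  set P := (Finset.range m).filter fun i => a (f i) with hP
  have hA : (W.filter fun u => a u ∧ G.Adj (f 0) u).card ≤ JA.card := by
    refine le_trans (Finset.card_le_card ?_) (Finset.card_image_le (s := JA) (f := f))
    intro y hy
    obtain ⟨hyW, hay, hxy⟩ := Finset.mem_filter.1 hy
    obtain ⟨i, hi, rfl⟩ := hon y hyW hxy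
    exact Finset.mem_image_of_mem _ (by simp [hJA, hi, hay, hxy])
  have hB : (W.filter fun u => ¬ a u ∧ G.Adj (f 0) u).card ≤ JB.card := by
    refine le_trans (Finset.card_le_card ?_) (Finset.card_image_le (s := JB) (f := f))
    intro y hy
    obtain ⟨hyW, hay, hxy⟩ := Finset.mem_filter.1 hy
    obtain ⟨i, hi, rfl⟩ := hon y hyW hxy
    exact Finset.mem_image_of_mem _ (by simp [hJB, hi, hay, hxy])
  have hne : ∀ i, G.Adj (f 0) (f i) → i ≠ 0 := by
    rintro i hi rfl
    exact G.loopless.irrefl _ hi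
  have hpred : ((JA ∪ JB).image fun i => i - 1).card = JA.card + JB.card := by
    rw [Finset.card_image_of_injOn, Finset.card_union_of_disjoint]
    · rw [Finset.disjoint_left]
      intro i h1 h2
      simp only [hJA, hJB, Finset.mem_filter] at h1 h2
      exact h2.2.1 h1.2.1
    · intro i hi j hj e
      have h1 : i ≠ 0 := hne i (by simp [hJA, hJB] at hi; tauto)
      have h2 : j ≠ 0 := hne j (by simp [hJA, hJB] at hj; tauto)
      simp only at e
      omega
  have hdisj : Disjoint JA ((JA ∪ JB).image fun i => i - 1) := by
    rw [Finset.disjoint_left]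
    intro i hi hi'
    obtain ⟨j, hj, rfl⟩ := Finset.mem_image.1 hi'
    have hj2 : j < m ∧ G.Adj (f 0) (f j) := by simp [hJA, hJB] at hj; tauto
    have := hne _ hj2.2
    simp only [hJA, Finset.mem_filter, Finset.mem_range] at hi
    have := hne _ hi.2.2
    obtain ⟨s, rfl⟩ : ∃ s, j = s + 2 := ⟨j - 2, by omega⟩
    exact hprev2 s hj2.1 hj2.2 (hprev s (by omega) hi.2.2)
  have hsub : JA ∪ ((JA ∪ JB).image fun i => i - 1) ⊆ P.erase (m - 1) := by
    intro i hi
    rw [Finset.mem_erase, hP, Finset.mem_filter, Finset.mem_range]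
    rcases Finset.mem_union.1 hi with hi | hi
    · simp only [hJA, Finset.mem_filter, Finset.mem_range] at hi
      refine ⟨?_, hi.1, hi.2.1⟩
      rintro rfl
      exact hpen (hprev (m - 2) (by omega) (by
        rw [show m - 2 + 1 = m - 1 by omega]; exact hi.2.2))
    · obtain ⟨j, hj, rfl⟩ := Finset.mem_image.1 hi
      have hj2 : j < m ∧ G.Adj (f 0) (f j) := by simp [hJA, hJB] at hj; tauto
      have := hne _ hj2.2
      obtain ⟨s, rfl⟩ : ∃ s, j = s + 1 := ⟨j - 1, by omega⟩
      exact ⟨by omega, by omega, hprev s hj2.1 hj2.2⟩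
  have hPk : P.card ≤ 2 * k := by
    have hk : 0 < 2 * k := by
      by_contra hk
      have := (halt 0 (by omega))
      simp [show k = 0 by omega, h.head] at this
    have h4 : m ≤ 4 * k := by
      by_contra hcon
      have h1 := (halt 0 (by omega)).2
      have h2 := (halt (2 * k) (by omega)).1
      simp at h1 h2
      exact h1 h2
    rw [← Finset.card_range (2 * k)]
    refine Finset.card_le_card_of_injOn (fun i => i % (2 * k))
      (fun i _ => by simpa using Nat.mod_lt _ hk) ?_
    have main : ∀ i j, i < j → j < m → a (f i) → a (f j) → i % (2 * k) = j % (2 * k) → False := by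
      intro i j hij hj hai haj e
      obtain ⟨d, hd⟩ := (Nat.modEq_iff_dvd' hij.le).1 e
      have hd1 : d = 1 := by
        have : d ≠ 0 := by rintro rfl; omega
        have : d < 2 := by
          by_contra hcon
          have := Nat.mul_le_mul_left (2 * k) (show 2 ≤ d by omega)
          omega
        omega
      subst hd1
      obtain rfl : j = i + 2 * k := by omega
      have h1 := halt i hj
      have := h1.1.1 hai
      have := h1.2.1 haj
      omega
    intro i hi j hj e
    simp only [hP, Finset.coe_filter, Finset.mem_range, Set.mem_ofPred_eq] at hi hj
    rcases lt_trichotomy i j with hij | hij | hij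
    · exact (main i j hij hj.1 hi.2 hj.2 e).elim
    · exact hij
    · exact (main j i hij hi.1 hj.2 hi.2 e.symm).elim
  have hmem : m - 1 ∈ P := by
    simp only [hP, Finset.mem_filter, Finset.mem_range]
    exact ⟨by omega, h.last⟩
  have h1 := Finset.card_le_card hsub
  rw [Finset.card_union_of_disjoint hdisj, hpred, Finset.card_erase_of_mem hmem] at h1
  have := Finset.card_pos.2 ⟨_, hmem⟩
  omega

/-- The vertex set of a cycle of order equal to that of a maximum path with ends in `a` is a
union of connected components of `W`, provided that vertices outside `a` have more than `k`
neighbours in `a`. -/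
theorem IsPathIn.not_adj_of_cycle [DecidableEq V] [DecidableRel G.Adj] [DecidablePred a]
    (h : IsPathIn G W f m) (hclose : G.Adj (f (m - 1)) (f 0)) (hmk : m ≤ 2 * k)
    (hmax : ∀ g n, IsEndedPathIn G a W g n → n ≤ m)
    (hno : ∀ g, ¬ IsEndedPathIn G a W g (2 * k + 1)) (hbb : ∀ u v, G.Adj u v → a u ∨ a v)
    (hdeg : ∀ x ∈ W, ¬ a x → k < (W.filter fun u => a u ∧ G.Adj x u).card)
    {z : V} (hz : z ∈ W) (hoff : ∀ i < m, f i ≠ z) :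
    ∀ i < m, ¬ G.Adj z (f i) := by
  have hm2 : 2 ≤ m := by
    by_contra hcon
    rw [show m - 1 = 0 by omega] at hclose
    exact G.loopless.irrefl _ hclose
  -- consequences for a cycle whose first vertex is adjacent to `z`
  have key : ∀ g, IsPathIn G W g m → (∀ i < m, g i ≠ z) → G.Adj (g (m - 1)) (g 0) →
      G.Adj z (g 0) → ¬ a z ∧ ¬ a (g (m - 1)) ∧ ∀ y ∈ W, G.Adj z y → ∃ i < m, g i = y := by
    intro g hg hgoff hgclose hzg
    have hpen : a (g (m - 1)) ∨ a (g (m - 2)) := by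
      have := hbb _ _ (hg.adj (m - 2) (by omega))
      rw [show m - 2 + 1 = m - 1 by omega] at this
      tauto
    have hcons := hg.cons hz hgoff hzg
    have haz : ¬ a z := by
      intro haz
      have hlast : ¬ a (g (m - 1)) := by
        intro hl
        have := hmax _ _ ⟨hcons, by omega, by simpa using haz, by
          simpa [show m ≠ 0 by omega] using hl⟩
        omega
      have hq : IsEndedPathIn G a W _ m := ⟨hcons.take m (by omega), by omega,
        by simpa using haz, by
        rw [if_neg (by omega), show m - 1 - 1 = m - 2 by omega]
        tauto⟩
      have hmem := hg.mem (m - 1) (by omega)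
      refine absurd (hdeg _ hmem hlast) (not_lt.2 ?_)
      refine hq.reverse.card_neighbors_le_of_off hmax hno hbb hmem ?_ ?_
      · intro i hi
        split_ifs with h1
        · exact (hgoff _ (by omega)).symm
        · intro e
          have := hg.inj _ (by omega) _ (by omega) e
          omega
      · have := hg.adj (m - 2) (by omega)
        rw [show m - 2 + 1 = m - 1 by omega] at this
        rw [if_neg (by omega), show m - 1 - 0 - 1 = m - 2 by omega]
        exact this.symm
    have ha0 : a (g 0) := (hbb _ _ hzg).resolve_left haz
    have hlast : ¬ a (g (m - 1)) := by
      intro hl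
      have hq : IsEndedPathIn G a W g m := ⟨hg, by omega, ha0, hl⟩
      exact absurd (hdeg z hz haz)
        (not_lt.2 (hq.card_neighbors_le_of_off hmax hno hbb hz hgoff hzg))
    refine ⟨haz, hlast, fun y hy hzy => ?_⟩
    by_contra! hyoff
    have h2 := hcons.cons hy (by
      intro i hi
      split_ifs
      · exact hzy.ne
      · exact hyoff _ (by omega)) (by simpa using hzy.symm)
    have := hmax _ (m + 1) ⟨h2.take _ (by omega), by omega,
      by simpa using (hbb _ _ hzy).resolve_left haz, by
      simp only [Nat.add_sub_cancel]
      rw [if_neg (by omega), if_neg (by omega), show m - 1 - 1 = m - 2 by omega]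
      tauto⟩
    omega
  have key' : ∀ i < m, G.Adj z (f i) →
      ¬ a z ∧ (1 ≤ i → ¬ a (f (i - 1))) ∧ ∀ y ∈ W, G.Adj z y → ∃ i < m, f i = y := by
    intro i hi hzi
    obtain ⟨h1, h2, h3⟩ := key _ (h.cycle_shift hclose hi) (by
      intro j hj
      split_ifs
      · exact hoff _ (by omega)
      · exact hoff _ (by omega)) (by
      rcases i with _ | i
      · simpa [show m - 1 < m by omega, show 0 < m by omega] using hclose
      · rw [if_neg (by omega), if_pos (by omega), show m - 1 + (i + 1) - m = i by omega, zero_add]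
        exact h.adj i hi) (by simpa [hi] using hzi)
    refine ⟨h1, fun hi1 => ?_, fun y hy hzy => ?_⟩
    · rwa [if_neg (by omega), show m - 1 + i - m = i - 1 by omega] at h2
    · obtain ⟨j, hj, e⟩ := h3 y hy hzy
      split_ifs at e
      · exact ⟨_, by omega, e⟩
      · exact ⟨_, by omega, e⟩
  intro i hi hzi
  obtain ⟨haz, -, hon⟩ := key' i hi hzi
  set I := (Finset.range m).filter fun i => a (f i) ∧ G.Adj z (f i) with hI
  have hcard : (W.filter fun u => a u ∧ G.Adj z u).card ≤ I.card := by
    refine le_trans (Finset.card_le_card ?_) (Finset.card_image_le (s := I) (f := f))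
    intro y hy
    obtain ⟨hyW, hay, hxy⟩ := Finset.mem_filter.1 hy
    obtain ⟨i, hi, rfl⟩ := hon y hyW hxy
    exact Finset.mem_image_of_mem _ (by simp [hI, hi, hay, hxy])
  have : 2 * I.card ≤ (Finset.range (m + 1)).card := by
    refine two_mul_card_le_of_no_consecutive ?_ (fun i hi => ?_) (fun i hi => ?_)
    · intro i hi hi1
      simp only [hI, Finset.mem_filter, Finset.mem_range] at hi hi1
      exact (key' _ hi1.1 hi1.2.2).2.1 (by omega) hi.2.1
    all_goals
      simp only [hI, Finset.mem_filter, Finset.mem_range] at hi ⊢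
      omega
  rw [Finset.card_range] at this
  have := hdeg z hz haz
  omega

/-- A path whose end vertices have degree sum at least its order, all their neighbours lying on
the path, has a vertex set that carries a cycle. -/
theorem IsPathIn.exists_cycle [DecidableEq V] [DecidableRel G.Adj]
    (h : IsPathIn G W f m) (hpos : 0 < m)
    (h0 : ∀ x ∈ W, G.Adj (f 0) x → ∃ i < m, f i = x)
    (h1 : ∀ x ∈ W, G.Adj (f (m - 1)) x → ∃ i < m, f i = x)
    (hdeg : m ≤ (W.filter fun u => G.Adj (f 0) u).card +
      (W.filter fun u => G.Adj (f (m - 1)) u).card) :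
    ∃ g, IsPathIn G W g m ∧ G.Adj (g (m - 1)) (g 0) := by
  set J0 := (Finset.range (m - 1)).filter fun i => G.Adj (f 0) (f (i + 1)) with hJ0
  set J1 := (Finset.range (m - 1)).filter fun i => G.Adj (f (m - 1)) (f i) with hJ1
  have hc0 : (W.filter fun u => G.Adj (f 0) u).card ≤ J0.card := by
    refine le_trans (Finset.card_le_card ?_)
      (Finset.card_image_le (s := J0) (f := fun i => f (i + 1)))
    intro y hy
    obtain ⟨hyW, hxy⟩ := Finset.mem_filter.1 hy
    obtain ⟨i, hi, rfl⟩ := h0 y hyW hxy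
    rcases i with _ | i
    · exact (G.loopless.irrefl _ hxy).elim
    · exact Finset.mem_image.2 ⟨i, by simp [hJ0, hxy]; omega, rfl⟩
  have hc1 : (W.filter fun u => G.Adj (f (m - 1)) u).card ≤ J1.card := by
    refine le_trans (Finset.card_le_card ?_) (Finset.card_image_le (s := J1) (f := f))
    intro y hy
    obtain ⟨hyW, hxy⟩ := Finset.mem_filter.1 hy
    obtain ⟨i, hi, rfl⟩ := h1 y hyW hxy
    have : i ≠ m - 1 := by
      rintro rfl
      exact G.loopless.irrefl _ hxy
    exact Finset.mem_image_of_mem _ (by simp [hJ1, hxy]; omega)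
  obtain ⟨i, hi⟩ : (J0 ∩ J1).Nonempty := by
    rw [Finset.nonempty_iff_ne_empty]
    intro hempty
    have h2 : J0 ∪ J1 ⊆ Finset.range (m - 1) :=
      Finset.union_subset (Finset.filter_subset _ _) (Finset.filter_subset _ _)
    have h3 := Finset.card_le_card h2
    rw [Finset.card_union_of_disjoint (Finset.disjoint_iff_inter_eq_empty.2 hempty),
      Finset.card_range] at h3
    omega
  simp only [hJ0, hJ1, Finset.mem_inter, Finset.mem_filter, Finset.mem_range] at hi
  refine ⟨_, h.rotate (s := i + 1) (by omega) hi.1.2, ?_⟩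
  rw [if_neg (by omega), if_pos (by omega)]
  simpa using hi.2.2

/-- If all vertices of `W` have large (weighted) degree, then `W` contains a small
union of connected components. -/
theorem exists_small_closed_subset [DecidableEq V] [DecidableRel G.Adj] [DecidablePred a]
    (hno : ∀ g, ¬ IsEndedPathIn G a W g (2 * k + 1)) (hbb : ∀ u v, G.Adj u v → a u ∨ a v)
    (hdegB : ∀ x ∈ W, ¬ a x → k < (W.filter fun u => a u ∧ G.Adj x u).card)
    (hdegA : ∀ x ∈ W, a x → 2 * k ≤ 2 * (W.filter fun u => a u ∧ G.Adj x u).card +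
      (W.filter fun u => ¬ a u ∧ G.Adj x u).card)
    (hne : ∃ x ∈ W, a x) :
    ∃ S ⊆ W, S.Nonempty ∧ S.card ≤ 2 * k ∧ ∀ u ∈ S, ∀ v ∈ W, v ∉ S → ¬ G.Adj v u := by
  classical
  have hbound : ∀ g n, IsEndedPathIn G a W g n → n ≤ W.card := by
    intro g n hg
    rw [← Finset.card_range n]
    refine Finset.card_le_card_of_injOn g (fun i hi => hg.mem i (by simpa using hi)) ?_
    intro i hi j hj e
    exact hg.inj i (by simpa using hi) j (by simpa using hj) e
  obtain ⟨x, hxW, hax⟩ := hne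
  have hone : ∃ g, IsEndedPathIn G a W g 1 :=
    ⟨fun _ => x, ⟨fun _ _ => hxW, fun _ _ _ _ _ => by omega, fun _ _ => by omega⟩, one_pos,
      hax, hax⟩
  have hW1 : 1 ≤ W.card := Finset.card_pos.2 ⟨x, hxW⟩
  obtain ⟨f, hf⟩ := Nat.findGreatest_spec (P := fun n => ∃ g, IsEndedPathIn G a W g n) hW1 hone
  set m := Nat.findGreatest (fun n => ∃ g, IsEndedPathIn G a W g n) W.card
  have hmax : ∀ g n, IsEndedPathIn G a W g n → n ≤ m := fun g n hg =>
    Nat.le_findGreatest (hbound g n hg) ⟨g, hg⟩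
  have hon : ∀ g, IsEndedPathIn G a W g m → ∀ x ∈ W, G.Adj (g 0) x → ∃ i < m, g i = x := by
    intro g hg x hx hadj
    by_contra! hoff
    by_cases hax : a x
    · have := hmax _ _ ⟨hg.cons hx hoff hadj.symm, by omega, by simpa using hax, by
        simpa [hg.pos.ne'] using hg.last⟩
      omega
    · exact absurd (hdegB x hx hax)
        (not_lt.2 (hg.card_neighbors_le_of_off hmax hno hbb hx hoff hadj.symm))
  have hmk : m ≤ 2 * k := by
    by_contra! hkm
    have := hf.weighted_degree_lt hno hbb hkm (hon f hf)
    have := hdegA _ (hf.mem 0 hf.pos) hf.head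
    omega
  have hdeg : ∀ x ∈ W, a x → k ≤ (W.filter fun u => G.Adj x u).card := by
    intro x hx hax
    have h1 := hdegA x hx hax
    have h2 := Finset.card_filter_add_card_filter_not (s := W.filter fun u => G.Adj x u) a
    rw [Finset.filter_filter, Finset.filter_filter] at h2
    simp only [and_comm] at h1 h2
    omega
  have hpos := hf.pos
  obtain ⟨g, hg, hclose⟩ := hf.exists_cycle hpos (hon f hf) (fun x hx hadj => by
      obtain ⟨i, hi, e⟩ := hon _ hf.reverse x hx (by simpa using hadj)
      exact ⟨_, by omega, e⟩) (by
      have := hdeg _ (hf.mem 0 hpos) hf.head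
      have := hdeg _ (hf.mem (m - 1) (by omega)) hf.last
      omega)
  refine ⟨(Finset.range m).image g, ?_, ?_, ?_, ?_⟩
  · intro y hy
    obtain ⟨i, hi, rfl⟩ := Finset.mem_image.1 hy
    exact hg.mem i (by simpa using hi)
  · exact ⟨g 0, Finset.mem_image_of_mem _ (by simpa using hpos)⟩
  · exact Finset.card_image_le.trans (by simpa using hmk)
  · intro u hu v hv hvS
    obtain ⟨i, hi, rfl⟩ := Finset.mem_image.1 hu
    refine hg.not_adj_of_cycle hclose hmk hmax hno hbb hdegB hv (fun j hj e => hvS ?_) i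
      (by simpa using hi)
    exact Finset.mem_image.2 ⟨j, by simpa using hj, e⟩

end MaximalPaths

section Counting

variable {V : Type*} {G : SimpleGraph V} {a : V → Prop} {W : Finset V} {k : ℕ}

/-- Without a path of order `2 * k + 1` with both ends in `a`, the number of adjacent pairs of
vertices of `W` whose second vertex is in `a` is bounded by a weighted size of `W`. -/
theorem card_adj_pairs_le [DecidableEq V] [DecidableRel G.Adj] [DecidablePred a]
    (hk : 1 ≤ k) (hno : ∀ g, ¬ IsEndedPathIn G a W g (2 * k + 1))
    (hbb : ∀ u v, G.Adj u v → a u ∨ a v) :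
    ((W ×ˢ W).filter fun p => G.Adj p.1 p.2 ∧ a p.2).card ≤
      ∑ x ∈ W, if a x then 2 * k - 1 else k := by
  induction W using Finset.strongInduction with
  | H W ih =>
    -- it suffices to delete a nonempty set that meets few pairs
    have hdel : ∀ S ⊆ W, S.Nonempty →
        ((W ×ˢ W).filter fun p => (G.Adj p.1 p.2 ∧ a p.2) ∧ (p.1 ∈ S ∨ p.2 ∈ S)).card ≤
          (∑ x ∈ S, if a x then 2 * k - 1 else k) →
        ((W ×ˢ W).filter fun p => G.Adj p.1 p.2 ∧ a p.2).card ≤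
          ∑ x ∈ W, if a x then 2 * k - 1 else k := by
      intro S hS hSne hle
      have h1 := ih (W \ S) (Finset.sdiff_ssubset hS hSne) fun g hg => hno g
        ⟨⟨fun i hi => (Finset.mem_sdiff.1 (hg.mem i hi)).1, hg.inj, hg.adj⟩,
          hg.pos, hg.head, hg.last⟩
      have h2 := Finset.sum_sdiff (f := fun x => if a x then 2 * k - 1 else k) hS
      have h3 : ((W ×ˢ W).filter fun p => G.Adj p.1 p.2 ∧ a p.2) ⊆
          (((W \ S) ×ˢ (W \ S)).filter fun p => G.Adj p.1 p.2 ∧ a p.2) ∪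
          ((W ×ˢ W).filter fun p => (G.Adj p.1 p.2 ∧ a p.2) ∧ (p.1 ∈ S ∨ p.2 ∈ S)) := by
        intro p hp
        simp only [Finset.mem_filter, Finset.mem_product, Finset.mem_union,
          Finset.mem_sdiff] at hp ⊢
        tauto
      have h4 := (Finset.card_le_card h3).trans (Finset.card_union_le _ _)
      omega
    by_cases hB : ∃ x ∈ W, ¬ a x ∧ (W.filter fun u => a u ∧ G.Adj x u).card ≤ k
    · obtain ⟨x, hx, hax, hc⟩ := hB
      refine hdel {x} (by simpa using hx) (by simp) ?_
      rw [Finset.sum_singleton, if_neg hax]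
      refine le_trans (Finset.card_le_card ?_)
        ((Finset.card_image_le (f := fun u => (x, u))).trans hc)
      rintro ⟨u, v⟩ hp
      simp only [Finset.mem_filter, Finset.mem_product, Finset.mem_singleton, Finset.mem_image,
        Prod.mk.injEq] at hp ⊢
      obtain ⟨⟨-, hv⟩, ⟨huv, hav⟩, rfl | rfl⟩ := hp
      · exact ⟨v, ⟨hv, hav, huv⟩, rfl, rfl⟩
      · exact (hax hav).elim
    by_cases hA : ∃ x ∈ W, a x ∧ 2 * (W.filter fun u => a u ∧ G.Adj x u).card +
        (W.filter fun u => ¬ a u ∧ G.Adj x u).card < 2 * k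
    · obtain ⟨x, hx, hax, hc⟩ := hA
      refine hdel {x} (by simpa using hx) (by simp) ?_
      rw [Finset.sum_singleton, if_pos hax]
      have hsub : ((W ×ˢ W).filter fun p =>
          (G.Adj p.1 p.2 ∧ a p.2) ∧ (p.1 ∈ ({x} : Finset V) ∨ p.2 ∈ ({x} : Finset V))) ⊆
          ((W.filter fun u => a u ∧ G.Adj x u).image fun u => (x, u)) ∪
          (((W.filter fun u => a u ∧ G.Adj x u).image fun u => (u, x)) ∪
          ((W.filter fun u => ¬ a u ∧ G.Adj x u).image fun u => (u, x))) := by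
        rintro ⟨u, v⟩ hp
        simp only [Finset.mem_filter, Finset.mem_product, Finset.mem_singleton, Finset.mem_image,
          Finset.mem_union, Prod.mk.injEq] at hp ⊢
        obtain ⟨⟨hu, hv⟩, ⟨huv, hav⟩, rfl | rfl⟩ := hp
        · exact .inl ⟨v, ⟨hv, hav, huv⟩, rfl, rfl⟩
        · by_cases hau : a u
          · exact .inr (.inl ⟨u, ⟨hu, hau, huv.symm⟩, rfl, rfl⟩)
          · exact .inr (.inr ⟨u, ⟨hu, hau, huv.symm⟩, rfl, rfl⟩)
      have h1 := (Finset.card_le_card hsub).trans ((Finset.card_union_le _ _).trans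
        (add_le_add Finset.card_image_le ((Finset.card_union_le _ _).trans
        (add_le_add Finset.card_image_le Finset.card_image_le))))
      omega
    by_cases hne : ∃ x ∈ W, a x
    · push Not at hA hB
      obtain ⟨S, hSW, hSne, hSc, hcl⟩ := exists_small_closed_subset hno hbb hB hA hne
      refine hdel S hSW hSne ?_
      have hsub : ((W ×ˢ W).filter fun p => (G.Adj p.1 p.2 ∧ a p.2) ∧ (p.1 ∈ S ∨ p.2 ∈ S)) ⊆
          (S.filter a).biUnion fun v => (S.erase v).image fun u => (u, v) := by
        rintro ⟨u, v⟩ hp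
        simp only [Finset.mem_filter, Finset.mem_product, Finset.mem_image, Finset.mem_biUnion,
          Finset.mem_erase, Prod.mk.injEq] at hp ⊢
        obtain ⟨⟨hu, hv⟩, ⟨huv, hav⟩, hS⟩ := hp
        have huS : u ∈ S := by
          by_contra huS
          exact hcl v (by tauto) u hu huS huv
        have hvS : v ∈ S := by
          by_contra hvS
          exact hcl u huS v hv hvS huv.symm
        exact ⟨v, ⟨hvS, hav⟩, u, ⟨huv.ne, huS⟩, rfl, rfl⟩
      calc _ ≤ _ := Finset.card_le_card hsub
        _ ≤ (S.filter a).card * (2 * k - 1) := by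
          refine Finset.card_biUnion_le_card_mul _ _ _ fun v hv => Finset.card_image_le.trans ?_
          rw [Finset.card_erase_of_mem (Finset.mem_filter.1 hv).1]
          omega
        _ ≤ _ := by
          rw [Finset.sum_ite, Finset.sum_const, smul_eq_mul]
          exact Nat.le_add_right _ _
    · push Not at hne
      rw [Finset.filter_false_of_mem]
      · simp
      · rintro ⟨u, v⟩ hp ⟨-, hav⟩
        exact hne v (Finset.mem_product.1 hp).2 hav

theorem two_mul_card_edges_add_card_cross_le [Fintype V] [DecidableEq V] [DecidableRel G.Adj]
    {A B : Finset V} (hdisj : Disjoint A B) :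
    2 * (G.edgeFinset.filter (fun e => ∀ v ∈ e, v ∈ A)).card
        + (G.edgeFinset.filter (fun e => ∃ a ∈ A, ∃ b ∈ B, e = s(a, b))).card ≤
      ((Finset.univ ×ˢ Finset.univ).filter fun p : V × V => G.Adj p.1 p.2 ∧ p.2 ∈ A).card := by
  classical
  let H : SimpleGraph V :=
    { Adj := fun u v => G.Adj u v ∧ u ∈ A ∧ v ∈ A
      symm := ⟨fun u v h => ⟨h.1.symm, h.2.2, h.2.1⟩⟩
      loopless := ⟨fun u h => G.loopless.irrefl u h.1⟩ }
  have hH : H.edgeFinset = G.edgeFinset.filter (fun e => ∀ v ∈ e, v ∈ A) := by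
    ext e
    induction e with
    | h u v => simp [H]
  have h1 : 2 * (G.edgeFinset.filter (fun e => ∀ v ∈ e, v ∈ A)).card =
      ((A ×ˢ A).filter fun p => G.Adj p.1 p.2).card := by
    rw [← hH, ← H.dart_card_eq_twice_card_edges, ← Finset.card_univ]
    refine Finset.card_bij (fun d _ => d.toProd) ?_ ?_ ?_
    · intro d _
      have := d.adj
      simp only [H] at this
      simp [this]
    · intro d _ d' _ e
      exact SimpleGraph.Dart.ext _ _ e
    · rintro ⟨u, v⟩ hp
      simp only [Finset.mem_filter, Finset.mem_product] at hp
      exact ⟨⟨(u, v), hp.2, hp.1.1, hp.1.2⟩, Finset.mem_univ _, rfl⟩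
  have h2 : (G.edgeFinset.filter (fun e => ∃ a ∈ A, ∃ b ∈ B, e = s(a, b))).card ≤
      ((B ×ˢ A).filter fun p => G.Adj p.1 p.2).card := by
    refine le_trans (Finset.card_le_card ?_) (Finset.card_image_le (f := fun p => s(p.1, p.2)))
    intro e he
    obtain ⟨he, u, hu, v, hv, rfl⟩ := Finset.mem_filter.1 he
    refine Finset.mem_image.2 ⟨(v, u), ?_, Sym2.eq_swap⟩
    simp only [SimpleGraph.mem_edgeFinset, SimpleGraph.mem_edgeSet] at he
    simp [hu, hv, he.symm]
  rw [h1]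
  refine (Nat.add_le_add_left h2 _).trans ?_
  rw [← Finset.card_union_of_disjoint]
  · refine Finset.card_le_card fun p hp => ?_
    simp only [Finset.mem_union, Finset.mem_filter, Finset.mem_product] at hp
    simp
    tauto
  · rw [Finset.disjoint_left]
    intro p hp hp'
    simp only [Finset.mem_filter, Finset.mem_product] at hp hp'
    exact Finset.disjoint_left.1 hdisj hp.1.1 hp'.1.1

end Counting

/-- Lemma 1, part (B). Let `k ≥ 1` and let the vertices of a graph `G`
be partitioned into two sets `A` and `B`. If `2·e_G(A) + e_G(A,B) > (2k−1)|A| + k|B|`,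
then `G` contains a path of order `2k+1` with both ends in `A`. -/
theorem degree_powers_stmt_1 {V : Type*} [Fintype V] [DecidableEq V]
    (G : SimpleGraph V) [DecidableRel G.Adj] (k : ℕ) (hk : 1 ≤ k)
    (A B : Finset V) (hdisj : Disjoint A B) (hcover : A ∪ B = Finset.univ)
    (hineq : 2 * (G.edgeFinset.filter (fun e => ∀ v ∈ e, v ∈ A)).card
        + (G.edgeFinset.filter (fun e => ∃ a ∈ A, ∃ b ∈ B, e = s(a, b))).card
        > (2 * k - 1) * A.card + k * B.card) :
    ∃ (u v : V) (p : G.Walk u v), p.IsPath ∧ u ∈ A ∧ v ∈ A ∧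
      p.length + 1 = 2 * k + 1 := by
  classical
  by_contra hcon
  let H : SimpleGraph V :=
    { Adj := fun u v => G.Adj u v ∧ (u ∈ A ∨ v ∈ A)
      symm := ⟨fun u v h => ⟨h.1.symm, h.2.symm⟩⟩
      loopless := ⟨fun u h => G.loopless.irrefl u h.1⟩ }
  have hno : ∀ g, ¬ IsEndedPathIn H (· ∈ A) Finset.univ g (2 * k + 1) := by
    intro g hg
    obtain ⟨p, hp, hl, -⟩ := IsPathIn.exists_walk (G := G) (2 * k)
      ⟨hg.mem, hg.inj, fun i hi => (hg.adj i hi).1⟩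
    exact hcon ⟨_, _, p, hp, hg.head, by simpa using hg.last, by rw [hl]⟩
  have h1 := card_adj_pairs_le hk hno fun u v h => h.2
  have h2 := two_mul_card_edges_add_card_cross_le (G := G) hdisj
  have h3 : ((Finset.univ ×ˢ Finset.univ).filter
      fun p : V × V => H.Adj p.1 p.2 ∧ p.2 ∈ A) =
      (Finset.univ ×ˢ Finset.univ).filter fun p : V × V => G.Adj p.1 p.2 ∧ p.2 ∈ A := by
    ext p
    simp only [H, Finset.mem_filter]
    tauto
  have h4 : (∑ x : V, if x ∈ A then 2 * k - 1 else k) = (2 * k - 1) * A.card + k * B.card := by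
    rw [← hcover, Finset.sum_union hdisj, Finset.sum_congr rfl fun x hx => if_pos hx,
      Finset.sum_congr rfl fun x hx => if_neg (Finset.disjoint_right.1 hdisj hx)]
    simp [mul_comm]
  rw [h3, h4] at h1
  omega
end

section
/- Let k ≥ 1 be an integer and let G be a finite simple graph with n vertices and m edges. If G contains no cycle of length 2k+2, then the sum over all vertices u of G of d_G(u)² is at most 2km + k(n−1)n. -/
open Finset

/-- `G.SpanPath x y s`: there is a path in `G` from `x` to `y` whose vertex set is `s`. -/
inductive SimpleGraph.SpanPath {V : Type*} (G : SimpleGraph V) : V → V → Finset V → Prop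
  | single (x : V) : SpanPath G x x {x}
  | cons {x y z : V} {s : Finset V} (h : G.Adj x y) (hx : x ∉ s) (p : SpanPath G y z s) :
      SpanPath G x z (Finset.cons x s hx)

namespace SimpleGraph

open scoped Classical in
theorem SpanPath.cons_insert {V : Type*} {G : SimpleGraph V} {x y z : V} {s : Finset V}
    (h : G.Adj x y) (hx : x ∉ s) (p : G.SpanPath y z s) : G.SpanPath x z (insert x s) := by
  rw [← Finset.cons_eq_insert x s hx]
  exact .cons h hx p

theorem SpanPath.left_mem {V : Type*} {G : SimpleGraph V} {x y : V} {s : Finset V}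
    (p : G.SpanPath x y s) : x ∈ s := by
  cases p <;> simp

open scoped Classical in
theorem SpanPath.append {V : Type*} {G : SimpleGraph V} {x y z w : V} {s t : Finset V}
    (p : G.SpanPath x y s) (q : G.SpanPath z w t) (h : G.Adj y z) (hd : Disjoint s t) :
    G.SpanPath x w (s ∪ t) := by
  induction p with
  | single x =>
    rw [← Finset.insert_eq]
    exact q.cons_insert h (by simpa using hd)
  | cons hxy hx p ih =>
    rw [Finset.cons_eq_insert] at hd ⊢
    rw [Finset.disjoint_insert_left] at hd
    rw [Finset.insert_union]
    exact (ih h hd.2).cons_insert hxy (by simp [hx, hd.1])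

theorem SpanPath.symm {V : Type*} {G : SimpleGraph V} {x y : V} {s : Finset V}
    (p : G.SpanPath x y s) : G.SpanPath y x s := by
  classical
  induction p with
  | single x => exact .single x
  | @cons x y z s hxy hx p ih =>
    have := ih.append (.single x) hxy.symm (by simpa using hx)
    rwa [Finset.union_comm, ← Finset.insert_eq, ← Finset.cons_eq_insert x s hx] at this

theorem SpanPath.mono {V : Type*} {G H : SimpleGraph V} (hGH : G ≤ H) {x y : V} {s : Finset V}
    (p : G.SpanPath x y s) : H.SpanPath x y s := by
  induction p with
  | single x => exact .single x
  | cons hxy hx p ih => exact .cons (hGH hxy) hx ih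

theorem SpanPath.exists_walk {V : Type*} {G : SimpleGraph V} {x y : V} {s : Finset V}
    (p : G.SpanPath x y s) :
    ∃ w : G.Walk x y, w.IsPath ∧ (∀ v, v ∈ w.support ↔ v ∈ s) ∧ w.length + 1 = s.card := by
  induction p with
  | single x => exact ⟨.nil, by simp⟩
  | cons hxy hx p ih =>
    obtain ⟨w, hw, hs, hl⟩ := ih
    refine ⟨.cons hxy w, ?_, ?_, ?_⟩
    · rw [Walk.cons_isPath_iff]
      exact ⟨hw, by rwa [hs]⟩
    · intro v
      simp [hs]
    · simp [hl]

/-- A path with all vertices in `s` together with a common neighbour of its ends outside `s`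
is a cycle. -/
theorem SpanPath.exists_cycle {V : Type*} {G : SimpleGraph V} {x y u : V} {s : Finset V}
    (p : G.SpanPath x y s) (hux : G.Adj u x) (huy : G.Adj u y) (hu : u ∉ s) (hs : 2 ≤ s.card) :
    ∃ c : G.Walk u u, c.IsCycle ∧ c.length = s.card + 1 := by
  obtain ⟨w, hw, hsup, hl⟩ := p.exists_walk
  refine ⟨.cons hux (w.concat huy.symm), ?_, by simp [hl]⟩
  rw [Walk.cons_isCycle_iff]
  constructor
  · exact hw.concat (by rwa [hsup]) _
  · rw [Walk.edges_concat, List.concat_eq_append, List.mem_append, List.mem_singleton]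
    rintro (h | h)
    · exact hu ((hsup u).1 (w.fst_mem_support_of_mem_edges h))
    · have hxy : x ≠ y := by
        rintro rfl
        have h0 := Walk.length_eq_zero_iff.2 (Walk.isPath_iff_nil.1 hw)
        omega
      rw [Sym2.eq_iff] at h
      rcases h with ⟨h, -⟩ | ⟨-, h⟩
      · exact huy.ne h
      · exact hxy h

/-- The sequence `v 0, v 1, …, v m` is a path of `G`. -/
structure IsPathSeq {V : Type*} (G : SimpleGraph V) (v : ℕ → V) (m : ℕ) : Prop where
  inj : ∀ i j, i ≤ m → j ≤ m → v i = v j → i = j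
  adj : ∀ i, i < m → G.Adj (v i) (v (i + 1))

open scoped Classical in
/-- The set of the entries of the sequence `v` from position `i` to position `j`. -/
noncomputable def seg {V : Type*} (v : ℕ → V) (i j : ℕ) : Finset V := (Finset.Icc i j).image v

namespace IsPathSeq

variable {V : Type*} {G : SimpleGraph V} {v : ℕ → V} {m : ℕ}

theorem mem_seg (h : G.IsPathSeq v m) {i j l : ℕ} (hj : j ≤ m) (hl : l ≤ m) :
    v l ∈ seg v i j ↔ i ≤ l ∧ l ≤ j := by
  simp only [seg, Finset.mem_image, Finset.mem_Icc]
  constructor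
  · rintro ⟨a, ha, hal⟩
    have := h.inj a l (by omega) hl hal
    omega
  · exact fun hl => ⟨l, hl, rfl⟩

open scoped Classical in
theorem card_seg (h : G.IsPathSeq v m) {i j : ℕ} (hj : j ≤ m) :
    (seg v i j).card = j + 1 - i := by
  rw [seg, Finset.card_image_of_injOn, Nat.card_Icc]
  intro a ha b hb hab
  simp only [Finset.coe_Icc, Set.mem_Icc] at ha hb
  exact h.inj a b (by omega) (by omega) hab

theorem disjoint_seg (h : G.IsPathSeq v m) {i j a b : ℕ} (hj : j < a) (hb : b ≤ m) :
    Disjoint (seg v i j) (seg v a b) := by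
  rw [Finset.disjoint_left]
  intro x hx hx'
  simp only [seg, Finset.mem_image, Finset.mem_Icc] at hx hx'
  obtain ⟨p, hp, rfl⟩ := hx
  obtain ⟨q, hq, hqp⟩ := hx'
  have := h.inj q p (by omega) (by omega) hqp
  omega

open scoped Classical in
theorem seg_subset {i j a b : ℕ} (hi : a ≤ i) (hj : j ≤ b) :
    seg v i j ⊆ seg v a b :=
  Finset.image_subset_image (Finset.Icc_subset_Icc hi hj)

open scoped Classical in
theorem seg_union {i j l : ℕ} (hij : i ≤ j) (hjl : j < l) :
    seg v i j ∪ seg v (j + 1) l = seg v i l := by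
  rw [seg, seg, seg, ← Finset.image_union]
  congr 1
  ext x
  simp only [Finset.mem_union, Finset.mem_Icc]
  omega

theorem spanPath (h : G.IsPathSeq v m) {i j : ℕ} (hij : i ≤ j) (hj : j ≤ m) :
    G.SpanPath (v i) (v j) (seg v i j) := by
  classical
  induction j, hij using Nat.le_induction with
  | base => simpa [seg] using SpanPath.single (G := G) (v i)
  | succ j hij ih =>
    have h1 := (ih (by omega)).append (.single (v (j + 1))) (h.adj j (by omega))
      (by rw [Finset.disjoint_singleton_right, h.mem_seg (by omega) hj]; omega)
    have h2 : seg v i j ∪ {v (j + 1)} = seg v i (j + 1) := by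
      rw [← seg_union hij (Nat.lt_succ_self j)]
      simp [seg]
    rwa [h2] at h1

end IsPathSeq

theorem SpanPath.exists_isPathSeq {V : Type*} {G : SimpleGraph V} {x y : V} {s : Finset V}
    (p : G.SpanPath x y s) :
    ∃ (v : ℕ → V) (m : ℕ), G.IsPathSeq v m ∧ v 0 = x ∧ v m = y ∧ s = seg v 0 m := by
  classical
  induction p with
  | single x => exact ⟨fun _ => x, 0, ⟨by omega, by omega⟩, rfl, rfl, by simp [seg]⟩
  | @cons x y z s hxy hx p ih =>
    obtain ⟨v, m, hv, h0, hm, rfl⟩ := ih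
    have hne : ∀ i, i ≤ m → x ≠ v i := by
      rintro i hi rfl
      exact hx ((hv.mem_seg le_rfl hi).2 ⟨by omega, hi⟩)
    refine ⟨fun i => if i = 0 then x else v (i - 1), m + 1, ⟨?_, ?_⟩, by simp, by simpa using hm, ?_⟩
    · intro i j hi hj hij
      rcases i with _ | i <;> rcases j with _ | j <;> simp at hij ⊢
      · exact hne j (by omega) hij
      · exact hne i (by omega) hij.symm
      · exact hv.inj i j (by omega) (by omega) hij
    · intro i hi
      rcases i with _ | i
      · simpa [h0] using hxy
      · simpa using hv.adj i (by omega)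
    · ext a
      simp only [seg, Finset.mem_cons, Finset.mem_image, Finset.mem_Icc]
      constructor
      · rintro (rfl | ⟨i, hi, rfl⟩)
        · exact ⟨0, by omega, by simp⟩
        · exact ⟨i + 1, by omega, by simp⟩
      · rintro ⟨i, hi, rfl⟩
        rcases i with _ | i
        · simp
        · exact Or.inr ⟨i, by omega, by simp⟩

end SimpleGraph

/-- A set of integers in an interval with no two consecutive elements has at most half of
the (rounded up) length of that interval. -/
theorem Finset.two_mul_card_le_of_no_consecutive {S : Finset ℕ} {a b : ℕ}
    (hS : S ⊆ Finset.Icc a b) (hc : ∀ i ∈ S, i + 1 ∉ S) : 2 * S.card ≤ b + 2 - a := by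
  have hd : Disjoint S (S.map (addRightEmbedding 1)) := by
    rw [Finset.disjoint_left]
    intro x hx hx'
    obtain ⟨y, hy, rfl⟩ := Finset.mem_map.1 hx'
    exact hc y hy hx
  have hsub : S ∪ S.map (addRightEmbedding 1) ⊆ Finset.Icc a (b + 1) := by
    intro x hx
    rcases Finset.mem_union.1 hx with hx | hx
    · have := Finset.mem_Icc.1 (hS hx)
      simp only [Finset.mem_Icc]
      omega
    · obtain ⟨y, hy, rfl⟩ := Finset.mem_map.1 hx
      have := Finset.mem_Icc.1 (hS hy)
      simp only [addRightEmbedding_apply, Finset.mem_Icc]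
      omega
  have := Finset.card_le_card hsub
  rw [Finset.card_union_of_disjoint hd, Finset.card_map, Nat.card_Icc] at this
  omega

/-- If a sequence starts in `A`, is in `A` at an odd position, and has no two consecutive
entries outside `A`, then it has two consecutive entries in `A`. -/
theorem exists_consecutive_mem {V : Type*} {A : Finset V} {v : ℕ → V} {i : ℕ} (hi : Odd i)
    (h0 : v 0 ∈ A) (hvi : v i ∈ A) (hcov : ∀ j < i, v j ∈ A ∨ v (j + 1) ∈ A) :
    ∃ j < i, v j ∈ A ∧ v (j + 1) ∈ A := by
  by_contra! hne
  have key : ∀ j ≤ i, (v j ∈ A ↔ Even j) := by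
    intro j
    induction j with
    | zero => simp [h0]
    | succ j ih =>
      intro hj
      have h1 := ih (by omega)
      have h2 := hcov j (by omega)
      have h3 := hne j (by omega)
      rw [Nat.even_add_one, ← h1]
      tauto
  exact Nat.not_even_iff_odd.2 hi ((key i le_rfl).1 hvi)

namespace SimpleGraph

namespace IsPathSeq

variable {V : Type*} {G : SimpleGraph V} {v : ℕ → V} {m : ℕ}

open scoped Classical in
/-- The path `v j, …, v a, v l, …, v m`. -/
theorem spanPath_jump (h : G.IsPathSeq v m) {a j l : ℕ} (haj : a ≤ j) (hjl : j < l) (hl : l ≤ m)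
    (hadj : G.Adj (v a) (v l)) :
    G.SpanPath (v j) (v m) (seg v a j ∪ seg v l m) ∧
      (seg v a j ∪ seg v l m).card = (j + 1 - a) + (m + 1 - l) := by
  have hd := h.disjoint_seg (i := a) hjl le_rfl
  refine ⟨(h.spanPath haj (by omega)).symm.append (h.spanPath hl le_rfl) hadj hd, ?_⟩
  rw [Finset.card_union_of_disjoint hd, h.card_seg (by omega), h.card_seg le_rfl]

/-- The path `v j, …, v a, v i, …, v (j + 1)`. -/
theorem spanPath_rotate (h : G.IsPathSeq v m) {a j i : ℕ} (haj : a ≤ j) (hji : j < i) (hi : i ≤ m)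
    (hadj : G.Adj (v a) (v i)) : G.SpanPath (v j) (v (j + 1)) (seg v a i) := by
  classical
  have hd := h.disjoint_seg (i := a) (Nat.lt_succ_self j) hi
  have := (h.spanPath haj (by omega)).symm.append (h.spanPath hji hi).symm hadj hd
  rwa [← seg_union haj hji]

open scoped Classical in
/-- The path `v j, …, v a, b, v i, …, v (j + 1)`. -/
theorem spanPath_rotate_insert (h : G.IsPathSeq v m) {a j i : ℕ} {b : V} (haj : a ≤ j)
    (hji : j < i) (hi : i ≤ m) (hb : b ∉ seg v 0 m) (hab : G.Adj (v a) b) (hbi : G.Adj b (v i)) :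
    G.SpanPath (v j) (v (j + 1)) (insert b (seg v a i)) ∧
      (insert b (seg v a i)).card = i + 2 - a := by
  have hba : b ∉ seg v a i := fun hb' => hb (seg_subset (Nat.zero_le _) hi hb')
  have hd := h.disjoint_seg (i := a) (Nat.lt_succ_self j) hi
  have hbd : b ∉ seg v (j + 1) i := fun hb' => hb (seg_subset (Nat.zero_le _) hi hb')
  have hbj : b ∉ seg v a j := fun hb' => hb (seg_subset (Nat.zero_le _) (by omega) hb')
  have h1 := (h.spanPath haj (by omega)).symm.append
    ((h.spanPath hji hi).symm.cons_insert hbi hbd) hab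
    (by rw [Finset.disjoint_insert_right]; exact ⟨hbj, hd⟩)
  rw [Finset.union_insert, seg_union haj hji] at h1
  refine ⟨h1, ?_⟩
  rw [Finset.card_insert_of_notMem hba, h.card_seg hi]
  omega

open scoped Classical in
/-- The path `v 0, …, v i, b, v (i + 1), …, v m`. -/
theorem spanPath_insert (h : G.IsPathSeq v m) {i : ℕ} {b : V} (hi : i < m)
    (hb : b ∉ seg v 0 m) (hab : G.Adj (v i) b) (hbi : G.Adj b (v (i + 1))) :
    G.SpanPath (v 0) (v m) (insert b (seg v 0 m)) ∧ (insert b (seg v 0 m)).card = m + 2 := by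
  have hbd : b ∉ seg v (i + 1) m := fun hb' => hb (seg_subset (Nat.zero_le _) le_rfl hb')
  have hbj : b ∉ seg v 0 i := fun hb' => hb (seg_subset le_rfl (by omega) hb')
  have hd := h.disjoint_seg (i := 0) (Nat.lt_succ_self i) le_rfl
  have h1 := (h.spanPath (Nat.zero_le i) (by omega)).append
    ((h.spanPath hi le_rfl).cons_insert hbi hbd) hab
    (by rw [Finset.disjoint_insert_right]; exact ⟨hbj, hd⟩)
  rw [Finset.union_insert, seg_union (Nat.zero_le i) hi] at h1
  refine ⟨h1, ?_⟩
  rw [Finset.card_insert_of_notMem hb, h.card_seg le_rfl]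
  omega

open scoped Classical in
theorem card_neighbors_le_of_subset_seg [Fintype V] {x : V}
    (hx : ∀ y, G.Adj x y → y ∈ seg v 0 m) :
    (univ.filter (G.Adj x)).card ≤ ((Finset.range (m + 1)).filter fun i => G.Adj x (v i)).card := by
  refine le_trans (Finset.card_le_card ?_) (Finset.card_image_le (f := v))
  intro y hy
  have hxy : G.Adj x y := (Finset.mem_filter.1 hy).2
  have := hx y hxy
  simp only [seg, Finset.mem_image, Finset.mem_Icc] at this
  obtain ⟨i, hi, rfl⟩ := this
  exact Finset.mem_image.2 ⟨i, by simp [hxy]; omega, rfl⟩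

end IsPathSeq

/-- Shortening a path with both ends in a vertex cover `A` by two vertices. -/
theorem SpanPath.exists_shorter {V : Type*} {G : SimpleGraph V} {A : Finset V}
    (hcov : ∀ u v, G.Adj u v → u ∈ A ∨ v ∈ A) {x y : V} {s : Finset V} (p : G.SpanPath x y s)
    (hx : x ∈ A) (hy : y ∈ A) (hs : 3 ≤ s.card) :
    ∃ x ∈ A, ∃ y ∈ A, ∃ t, G.SpanPath x y t ∧ t.card + 2 = s.card := by
  obtain ⟨v, m, hv, rfl, rfl, rfl⟩ := p.exists_isPathSeq
  rw [hv.card_seg le_rfl] at hs ⊢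
  by_cases h1 : v 1 ∈ A
  · by_cases h2 : v (m - 1) ∈ A
    · refine ⟨_, h1, _, h2, _, hv.spanPath (by omega) (by omega), ?_⟩
      rw [hv.card_seg (by omega)]
      omega
    · have h3 := (hcov _ _ (hv.adj (m - 2) (by omega))).resolve_right
        (by rwa [show m - 2 + 1 = m - 1 by omega])
      refine ⟨_, hx, _, h3, _, hv.spanPath (by omega) (by omega), ?_⟩
      rw [hv.card_seg (by omega)]
      omega
  · have h3 := (hcov _ _ (hv.adj 1 (by omega))).resolve_left h1
    refine ⟨_, h3, _, hy, _, hv.spanPath (by omega) le_rfl, ?_⟩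
    rw [hv.card_seg (by omega)]
    omega

theorem SpanPath.exists_of_odd {V : Type*} {G : SimpleGraph V} {A : Finset V}
    (hcov : ∀ u v, G.Adj u v → u ∈ A ∨ v ∈ A) {k : ℕ} {x y : V} {s : Finset V}
    (p : G.SpanPath x y s) (hx : x ∈ A) (hy : y ∈ A) (hodd : Odd s.card)
    (hs : 2 * k + 1 ≤ s.card) :
    ∃ x ∈ A, ∃ y ∈ A, ∃ t, G.SpanPath x y t ∧ t.card = 2 * k + 1 := by
  induction hn : s.card using Nat.strong_induction_on generalizing x y s with
  | _ n ih =>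
    subst hn
    rcases hs.eq_or_lt with h | h
    · exact ⟨x, hx, y, hy, s, p, h.symm⟩
    · obtain ⟨c, hc⟩ := hodd
      obtain ⟨x', hx', y', hy', t, q, ht⟩ := p.exists_shorter hcov hx hy (by omega)
      exact ih t.card (by omega) q hx' hy' ⟨c - 1, by omega⟩ (by omega) rfl

open scoped Classical in
/-- `A` is a vertex cover of `G`, the degrees in `G` are large, and the paths with an odd number
of vertices and both ends in `A` are short. -/
structure IsShortOddCover {V : Type*} [Fintype V] (G : SimpleGraph V) (A : Finset V) (k : ℕ) :
    Prop where
  cover : ∀ u v, G.Adj u v → u ∈ A ∨ v ∈ A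
  degree_of_notMem : ∀ b, b ∉ A → ∀ a, G.Adj b a → k + 1 ≤ (univ.filter (G.Adj b)).card
  degree_of_mem : ∀ a ∈ A, k ≤ (univ.filter (G.Adj a)).card
  card_lt : ∀ x ∈ A, ∀ y ∈ A, ∀ s, G.SpanPath x y s → Odd s.card → s.card < 2 * k + 1

namespace IsShortOddCover

variable {V : Type*} [Fintype V] {G : SimpleGraph V} {A : Finset V} {k M : ℕ}

theorem exists_consecutive (hG : G.IsShortOddCover A k) {v : ℕ → V} {m : ℕ}
    (hv : G.IsPathSeq v m) {i : ℕ} (hi : Odd i) (him : i ≤ m) (h0 : v 0 ∈ A) (hvi : v i ∈ A) :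
    ∃ j < i, v j ∈ A ∧ v (j + 1) ∈ A :=
  exists_consecutive_mem hi h0 hvi fun j hj => hG.cover _ _ (hv.adj j (by omega))

theorem mem_of_adj_left (hG : G.IsShortOddCover A k) (hk : 1 ≤ k)
    (hmax : ∀ x ∈ A, ∀ y ∈ A, ∀ s, G.SpanPath x y s → s.card ≤ M)
    {x y : V} {s : Finset V} (hx : x ∈ A) (hy : y ∈ A) (p : G.SpanPath x y s) (hs : s.card = M)
    {z : V} (hz : G.Adj x z) : z ∈ s := by
  classical
  by_contra hzs
  by_cases hzA : z ∈ A
  · have := hmax z hzA y hy _ (p.cons_insert hz.symm hzs)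
    rw [Finset.card_insert_of_notMem hzs] at this
    omega
  have hdeg := hG.degree_of_notMem z hzA x hz.symm
  have hnb : ∀ w, G.Adj z w → w ∈ A := fun w hw => (hG.cover _ _ hw).resolve_left hzA
  have hin : ∀ w, G.Adj z w → w ∈ s := by
    intro w hw
    by_contra hws
    have hwz : w ∉ insert z s := by simp [hws, hw.ne']
    have := hmax w (hnb w hw) y hy _ ((p.cons_insert hz.symm hzs).cons_insert hw.symm hwz)
    rw [Finset.card_insert_of_notMem hwz, Finset.card_insert_of_notMem hzs] at this
    omega
  obtain ⟨v, m, hv, rfl, rfl, rfl⟩ := p.exists_isPathSeq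
  rw [hv.card_seg le_rfl] at hs
  have hle := IsPathSeq.card_neighbors_le_of_subset_seg hin
  have := Finset.two_mul_card_le_of_no_consecutive (a := 0) (b := 2 * k - 1)
    (S := (Finset.range (m + 1)).filter fun i => G.Adj z (v i)) ?_ ?_
  · omega
  · intro i hi
    simp only [Finset.mem_filter, Finset.mem_range] at hi
    obtain ⟨him, hzi⟩ := hi
    simp only [Finset.mem_Icc]
    refine ⟨by omega, ?_⟩
    have hiA := hnb _ hzi
    rcases Nat.even_or_odd i with he | ho
    · have := hG.card_lt _ hx _ hiA _ (hv.spanPath (Nat.zero_le i) (by omega))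
      rw [hv.card_seg (by omega)] at this
      have := this (by simpa using he.add_one)
      omega
    · obtain ⟨j, hj, hj1, hj2⟩ := hG.exists_consecutive hv ho (by omega) hx hiA
      obtain ⟨q, hq⟩ :=
        hv.spanPath_rotate_insert (Nat.zero_le j) hj (by omega) hzs hz hzi
      have := hG.card_lt _ hj1 _ hj2 _ q
      rw [hq] at this
      have := this (by simpa using ho.add_even even_two)
      omega
  · intro i hi hi'
    simp only [Finset.mem_filter, Finset.mem_range] at hi hi'
    obtain ⟨q, hq⟩ := hv.spanPath_insert (by omega) hzs hi.2.symm hi'.2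
    have := hmax _ hx _ hy _ q
    omega

/-- The longest path with both ends in `A` has at most `2 * k` vertices. -/
theorem card_le_two_mul (hG : G.IsShortOddCover A k) (hk : 1 ≤ k)
    (hmax : ∀ x ∈ A, ∀ y ∈ A, ∀ s, G.SpanPath x y s → s.card ≤ M)
    {x y : V} {s : Finset V} (hx : x ∈ A) (hy : y ∈ A) (p : G.SpanPath x y s)
    (hs : s.card = M) : M ≤ 2 * k := by
  classical
  by_contra! hM
  have hpar := hG.card_lt x hx y hy s p
  have hnbs : ∀ z, G.Adj x z → z ∈ s := fun z hz => hG.mem_of_adj_left hk hmax hx hy p hs hz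
  obtain ⟨v, m, hv, rfl, rfl, rfl⟩ := p.exists_isPathSeq
  rw [hv.card_seg le_rfl] at hs hpar
  have hmo : Odd m := by
    by_contra hme
    have := hpar (by simpa using (Nat.not_odd_iff_even.1 hme).add_one)
    omega
  have hm1 : 2 * k + 1 ≤ m := by
    obtain ⟨c, hc⟩ := hmo
    omega
  -- no path with both ends in `A` has exactly `m` vertices
  have hnot : ∀ x ∈ A, ∀ y ∈ A, ∀ s, G.SpanPath x y s → s.card ≠ m := by
    intro x hx y hy s p hsm
    have := hG.card_lt x hx y hy s p (by rwa [hsm])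
    omega
  have hv1 : v 1 ∉ A := by
    intro h1
    refine hnot _ h1 _ hy _ (hv.spanPath (by omega) le_rfl) ?_
    rw [hv.card_seg le_rfl]
    omega
  have hnb : ∀ w, G.Adj (v 1) w → w ∈ A := fun w hw => (hG.cover _ _ hw).resolve_left hv1
  have hpre : ∀ i, 3 ≤ i → i ≤ m → G.Adj (v 1) (v i) → v (i - 1) ∉ A := by
    intro i hi him h1i hA
    obtain ⟨q, hq⟩ := hv.spanPath_jump (a := 1) (j := i - 1) (by omega) (by omega) him h1i
    exact hnot _ hA _ hy _ q (by omega)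
  -- the second vertex has a neighbour outside the path
  obtain ⟨z, hz, hzs⟩ : ∃ z, G.Adj (v 1) z ∧ z ∉ seg v 0 m := by
    by_contra! hin
    have hle := IsPathSeq.card_neighbors_le_of_subset_seg hin
    have hdeg := hG.degree_of_notMem _ hv1 _ (hv.adj 0 (by omega)).symm
    have := Finset.two_mul_card_le_of_no_consecutive (a := 0) (b := 2 * k - 1)
      (S := (Finset.range (m + 1)).filter fun i => G.Adj (v 1) (v i)) ?_ ?_
    · omega
    · intro i hi
      simp only [Finset.mem_filter, Finset.mem_range] at hi
      obtain ⟨him, h1i⟩ := hi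
      simp only [Finset.mem_Icc]
      refine ⟨by omega, ?_⟩
      have hiA := hnb _ h1i
      rcases Nat.even_or_odd i with he | ho
      · have := hG.card_lt _ hx _ hiA _ (hv.spanPath (Nat.zero_le i) (by omega))
        rw [hv.card_seg (by omega)] at this
        have := this (by simpa using he.add_one)
        omega
      · obtain ⟨j, hj, hj1, hj2⟩ := hG.exists_consecutive hv ho (by omega) hx hiA
        have hj0 : 1 ≤ j := by
          rcases j with _ | j
          · exact absurd hj2 hv1
          · omega
        have := hG.card_lt _ hj1 _ hj2 _ (hv.spanPath_rotate hj0 hj (by omega) h1i)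
        rw [hv.card_seg (by omega)] at this
        have := this (by simpa using ho)
        obtain ⟨c, hc⟩ := ho
        omega
    · intro i hi hi'
      simp only [Finset.mem_filter, Finset.mem_range] at hi hi'
      by_cases h3 : 3 ≤ i + 1
      · exact hpre (i + 1) h3 (by omega) hi'.2 (hnb _ hi.2)
      · obtain rfl | rfl : i = 0 ∨ i = 1 := by omega
        · exact hi'.2.ne rfl
        · exact hi.2.ne rfl
  have hzA := hnb z hz
  have hle := IsPathSeq.card_neighbors_le_of_subset_seg hnbs
  have hdeg := hG.degree_of_mem _ hx
  have hpre1 : ∀ i, 2 ≤ i → i ≤ m → G.Adj (v 0) (v i) → v (i - 1) ∈ A := by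
    intro i hi him h0i
    by_contra hA
    have hA2 : v (i - 2) ∈ A := (hG.cover _ _ (hv.adj (i - 2) (by omega))).resolve_right
      (by rwa [show i - 2 + 1 = i - 1 by omega])
    obtain ⟨q, hq⟩ := hv.spanPath_jump (a := 0) (j := i - 2) (by omega) (by omega) him h0i
    exact hnot _ hA2 _ hy _ q (by omega)
  have hpre2 : ∀ i, 2 ≤ i → i ≤ m → G.Adj (v 0) (v i) → v (i - 2) ∉ A := by
    intro i hi him h0i hA
    obtain ⟨q, hq⟩ := hv.spanPath_jump (a := 0) (j := i - 2) (by omega) (by omega) him h0i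
    exact hnot _ hA _ hy _ q (by omega)
  have hz0 : z ∉ seg v 1 m := fun h => hzs (IsPathSeq.seg_subset (by omega) le_rfl h)
  have := Finset.two_mul_card_le_of_no_consecutive (a := 1) (b := 2 * k - 2)
    (S := (Finset.range (m + 1)).filter fun i => G.Adj (v 0) (v i)) ?_ ?_
  · omega
  · intro i hi
    simp only [Finset.mem_filter, Finset.mem_range] at hi
    obtain ⟨him, h0i⟩ := hi
    have hi0 : i ≠ 0 := by
      rintro rfl
      exact h0i.ne rfl
    simp only [Finset.mem_Icc]
    refine ⟨by omega, ?_⟩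
    rcases Nat.even_or_odd i with he | ho
    · have hi2 : 2 ≤ i := by
        obtain ⟨c, hc⟩ := he
        omega
      have hiA := hpre1 i hi2 (by omega) h0i
      obtain ⟨j, hj, hj1, hj2⟩ :=
        hG.exists_consecutive hv (i := i - 1) (by
          obtain ⟨c, hc⟩ := he
          exact ⟨c - 1, by omega⟩) (by omega) hx hiA
      have := hG.card_lt _ hj1 _ hj2 _
        (hv.spanPath_rotate (Nat.zero_le j) (by omega) (by omega) h0i)
      rw [hv.card_seg (by omega)] at this
      have := this (by simpa using he.add_one)
      obtain ⟨c, hc⟩ := he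
      omega
    · have hzi : z ∉ seg v 0 i := fun h => hzs (IsPathSeq.seg_subset le_rfl (by omega) h)
      have hsub : seg v 1 i ⊆ seg v 0 i := IsPathSeq.seg_subset (by omega) le_rfl
      have q := (hv.spanPath (i := 1) (j := i) (by omega) (by omega)).cons_insert hz.symm
        (fun h => hzi (hsub h))
      have hz1 : z ∉ seg v 1 i := fun h => hzi (hsub h)
      have h0s : v 0 ∉ insert z (seg v 1 i) := by
        rw [Finset.mem_insert, hv.mem_seg (by omega) (by omega)]
        rintro (rfl | h)
        · exact hzs ((hv.mem_seg le_rfl (by omega)).2 (by omega))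
        · omega
      have := hG.card_lt _ hx _ hzA _ (q.symm.cons_insert h0i h0s)
      rw [Finset.card_insert_of_notMem h0s, Finset.card_insert_of_notMem hz1,
        hv.card_seg (by omega)] at this
      obtain ⟨c, hc⟩ := ho
      have := this ⟨c + 1, by omega⟩
      omega
  · intro i hi hi'
    simp only [Finset.mem_filter, Finset.mem_range] at hi hi'
    have hi0 : i ≠ 0 := by
      rintro rfl
      exact hi.2.ne rfl
    have h1 := hpre1 (i + 1) (by omega) (by omega) hi'.2
    have h2 := hpre2 (i + 1) (by omega) (by omega) hi'.2
    by_cases h3 : 2 ≤ i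
    · exact h2 (hpre1 i h3 (by omega) hi.2)
    · obtain rfl : i = 1 := by omega
      exact hv1 h1

open scoped Classical in
/-- There is a small nonempty set of vertices, meeting `A`, with no edges leaving it. -/
theorem exists_closed (hG : G.IsShortOddCover A k) (hk : 1 ≤ k) (hA : A.Nonempty) :
    ∃ T : Finset V, (T ∩ A).Nonempty ∧ T.card ≤ 2 * k ∧ ∀ t ∈ T, ∀ x ∉ T, ¬ G.Adj t x := by
  -- a longest path with both ends in `A`
  obtain ⟨M, ⟨x, hx, y, hy, s, p, hs⟩, hmax⟩ :
      ∃ M, (∃ x ∈ A, ∃ y ∈ A, ∃ s, G.SpanPath x y s ∧ s.card = M) ∧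
        ∀ x ∈ A, ∀ y ∈ A, ∀ s, G.SpanPath x y s → s.card ≤ M := by
    obtain ⟨a, ha⟩ := hA
    let P : ℕ → Prop := fun M => ∃ x ∈ A, ∃ y ∈ A, ∃ s, G.SpanPath x y s ∧ s.card = M
    have hP1 : P 1 := ⟨a, ha, a, ha, {a}, .single a, by simp⟩
    have hb : 1 ≤ Fintype.card V := Fintype.card_pos_iff.2 ⟨a⟩
    refine ⟨Nat.findGreatest P (Fintype.card V), Nat.findGreatest_spec (P := P) hb hP1, ?_⟩
    intro x hx y hy s p
    exact Nat.le_findGreatest (Finset.card_le_univ s) ⟨x, hx, y, hy, s, p, rfl⟩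
  have hM := hG.card_le_two_mul hk hmax hx hy p hs
  have hext : ∀ x ∈ A, ∀ y ∈ A, ∀ s, G.SpanPath x y s → s.card = M → ∀ z, G.Adj x z → z ∈ s :=
    fun x hx y hy s p hs z hz => hG.mem_of_adj_left hk hmax hx hy p hs hz
  -- a path on the same vertices whose ends are adjacent
  obtain ⟨x', y', p', hadj⟩ : ∃ x' y', G.SpanPath x' y' s ∧ G.Adj x' y' := by
    have hn1 := hext x hx y hy s p hs
    have hn2 := hext y hy x hx s p.symm hs
    have hd1 := hG.degree_of_mem x hx
    have hd2 := hG.degree_of_mem y hy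
    obtain ⟨v, m, hv, rfl, rfl, rfl⟩ := p.exists_isPathSeq
    rw [hv.card_seg le_rfl] at hs
    have h2 := IsPathSeq.card_neighbors_le_of_subset_seg hn2
    have h1 := IsPathSeq.card_neighbors_le_of_subset_seg hn1
    set S₁ := (Finset.range m).filter fun i => G.Adj (v 0) (v (i + 1)) with hS₁
    set S₂ := (Finset.range m).filter fun i => G.Adj (v m) (v i) with hS₂
    have hc1 : ((Finset.range (m + 1)).filter fun i => G.Adj (v 0) (v i)).card ≤ S₁.card := by
      refine le_trans (Finset.card_le_card (t := S₁.image (· + 1)) ?_) Finset.card_image_le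
      intro i hi
      simp only [Finset.mem_filter, Finset.mem_range] at hi
      rcases i with _ | i
      · exact absurd rfl hi.2.ne
      · exact Finset.mem_image.2 ⟨i, by simp [hS₁, hi.2]; omega, rfl⟩
    have hc2 : ((Finset.range (m + 1)).filter fun i => G.Adj (v m) (v i)).card ≤ S₂.card := by
      refine Finset.card_le_card ?_
      intro i hi
      simp only [Finset.mem_filter, Finset.mem_range] at hi
      have him : i ≠ m := by
        rintro rfl
        exact hi.2.ne rfl
      simp only [hS₂, Finset.mem_filter, Finset.mem_range]
      exact ⟨by omega, hi.2⟩
    have hnd : ¬ Disjoint S₁ S₂ := by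
      intro hd
      have := Finset.card_le_card (Finset.union_subset (Finset.filter_subset _ _)
        (Finset.filter_subset _ _) : S₁ ∪ S₂ ⊆ Finset.range m)
      rw [Finset.card_union_of_disjoint hd, Finset.card_range] at this
      omega
    obtain ⟨i, hi1, hi2⟩ := Finset.not_disjoint_iff.1 hnd
    simp only [hS₁, hS₂, Finset.mem_filter, Finset.mem_range] at hi1 hi2
    have hd := hv.disjoint_seg (i := 0) (Nat.lt_succ_self i) le_rfl
    have q := (hv.spanPath (Nat.zero_le i) (by omega)).append
      (hv.spanPath (i := i + 1) (j := m) hi1.1 le_rfl).symm hi2.2.symm hd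
    rw [IsPathSeq.seg_union (Nat.zero_le i) hi1.1] at q
    exact ⟨_, _, q, hi1.2⟩
  have hxs : x ∈ s := p.left_mem
  clear p
  obtain ⟨u, m, hu, rfl, rfl, rfl⟩ := p'.exists_isPathSeq
  have hm0 : 0 < m := by
    rcases Nat.eq_zero_or_pos m with rfl | h
    · exact absurd rfl hadj.ne
    · exact h
  have hcyc : ∀ j < m, G.SpanPath (u j) (u (j + 1)) (seg u 0 m) := fun j hj =>
    hu.spanPath_rotate (Nat.zero_le j) hj le_rfl hadj
  have hsucc : ∀ c ∈ seg u 0 m, ∃ c', G.Adj c c' ∧ G.SpanPath c c' (seg u 0 m) := by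
    intro c hc
    simp only [seg, Finset.mem_image, Finset.mem_Icc] at hc
    obtain ⟨j, hj, rfl⟩ := hc
    rcases hj.2.eq_or_lt with rfl | hjm
    · exact ⟨u 0, hadj.symm, p'.symm⟩
    · exact ⟨_, hu.adj j hjm, hcyc j hjm⟩
  have hcard := hu.card_seg (i := 0) le_rfl
  refine ⟨_, ⟨x, Finset.mem_inter.2 ⟨hxs, hx⟩⟩, by omega, ?_⟩
  intro c hc z hz hcz
  obtain ⟨c', hcc', q⟩ := hsucc c hc
  by_cases hcA : c ∈ A
  · by_cases hc'A : c' ∈ A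
    · exact hz (hext c hcA c' hc'A _ q hs z hcz)
    · generalize hS : seg u 0 m = S at *
      cases hq : q.symm with
      | single => exact hcc'.ne rfl
      | @cons _ w _ t hcw hct r =>
        rw [Finset.card_cons] at hs
        have hwA := (hG.cover _ _ hcw).resolve_left hc'A
        have hzt : z ∉ t := fun h => hz (Finset.mem_cons_of_mem h)
        have hzc' : z ≠ c' := fun h => hz (h ▸ Finset.mem_cons_self _ _)
        have r1 := r.symm.cons_insert hcz.symm hzt
        by_cases hzA : z ∈ A
        · have := hext w hwA z hzA _ r1.symm
            (by rw [Finset.card_insert_of_notMem hzt, hs]) c' hcw.symm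
          rcases Finset.mem_insert.1 this with h | h
          · exact hzc' h.symm
          · exact hct h
        · have hnb : ∀ b, G.Adj z b → b ∈ A := fun b hb => (hG.cover _ _ hb).resolve_left hzA
          have hin : ∀ b, G.Adj z b → b ∈ Finset.cons c' t hct := by
            intro b hb
            by_contra hbt
            have hbz : b ∉ insert z t := by
              rw [Finset.mem_insert]
              rintro (h | h)
              · exact hb.ne h.symm
              · exact hbt (Finset.mem_cons_of_mem h)
            have := hmax b (hnb b hb) w hwA _ (r1.cons_insert hb.symm hbz)
            rw [Finset.card_insert_of_notMem hbz, Finset.card_insert_of_notMem hzt] at this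
            omega
          have hdeg := hG.degree_of_notMem z hzA c hcz.symm
          have hle := IsPathSeq.card_neighbors_le_of_subset_seg (v := u) (m := m)
            (x := z) (by rwa [hS])
          have := Finset.two_mul_card_le_of_no_consecutive (a := 0) (b := 2 * k - 1)
            (S := (Finset.range (m + 1)).filter fun i => G.Adj z (u i)) ?_ ?_
          · omega
          · intro i hi
            simp only [Finset.mem_filter, Finset.mem_range] at hi
            simp only [Finset.mem_Icc]
            rw [Finset.card_cons] at hcard
            omega
          · intro i hi hi'
            simp only [Finset.mem_filter, Finset.mem_range] at hi hi'
            exact hz (hext _ (hnb _ hi.2) _ (hnb _ hi'.2) _ (hcyc i (by omega))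
              (by rw [Finset.card_cons, hs]) z hi.2.symm)
  · have hzA := (hG.cover _ _ hcz).resolve_left hcA
    have hc'A := (hG.cover _ _ hcc').resolve_left hcA
    have := hmax z hzA c' hc'A _ (q.cons_insert hcz.symm hz)
    rw [Finset.card_insert_of_notMem hz] at this
    omega

end IsShortOddCover

/-- The graph `G` with all edges meeting `T` deleted. -/
def isolate {V : Type*} (G : SimpleGraph V) (T : Finset V) : SimpleGraph V where
  Adj u v := G.Adj u v ∧ u ∉ T ∧ v ∉ T
  symm := ⟨fun _ _ h => ⟨h.1.symm, h.2.2, h.2.1⟩⟩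
  loopless := ⟨fun _ h => h.1.ne rfl⟩

theorem isolate_adj {V : Type*} {G : SimpleGraph V} {T : Finset V} {u v : V} :
    (G.isolate T).Adj u v ↔ G.Adj u v ∧ u ∉ T ∧ v ∉ T := Iff.rfl

theorem isolate_le {V : Type*} (G : SimpleGraph V) (T : Finset V) : G.isolate T ≤ G :=
  fun _ _ h => h.1

open scoped Classical in
theorem sum_card_neighbors_eq {V : Type*} [Fintype V] (G : SimpleGraph V) (A T : Finset V) :
    ∑ a ∈ A, (univ.filter (G.Adj a)).card =
      ∑ a ∈ A \ T, (univ.filter ((G.isolate T).Adj a)).card +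
      (∑ a ∈ A \ T, (T.filter (G.Adj a)).card + ∑ a ∈ A ∩ T, (univ.filter (G.Adj a)).card) := by
  rw [← Finset.sum_sdiff (Finset.inter_subset_left : A ∩ T ⊆ A), ← add_assoc,
    Finset.sdiff_inter_self_left, ← Finset.sum_add_distrib]
  congr 1
  refine Finset.sum_congr rfl fun a ha => ?_
  have haT := (Finset.mem_sdiff.1 ha).2
  rw [← Finset.card_union_of_disjoint]
  · congr 1
    ext x
    simp only [Finset.mem_filter, Finset.mem_univ, true_and, Finset.mem_union]
    rw [isolate_adj]
    tauto
  · rw [Finset.disjoint_left]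
    intro x hx hx'
    exact (Finset.mem_filter.1 hx).2.2.2 (Finset.mem_filter.1 hx').1

open scoped Classical in
/-- If the vertex cover `A` of `G` has large degree sum, then `G` has a path on `2 * k + 1`
vertices with both ends in `A`. -/
theorem sum_card_neighbors_le {V : Type*} [Fintype V] {k : ℕ} (hk : 1 ≤ k) (G : SimpleGraph V)
    (A B : Finset V) (hAB : Disjoint A B) (hcov : ∀ u v, G.Adj u v → u ∈ A ∨ v ∈ A)
    (hmem : ∀ u v, G.Adj u v → u ∈ A ∨ u ∈ B)
    (hno : ∀ x ∈ A, ∀ y ∈ A, ∀ s, G.SpanPath x y s → s.card ≠ 2 * k + 1) :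
    ∑ a ∈ A, (univ.filter (G.Adj a)).card ≤ (2 * k - 1) * A.card + k * B.card := by
  induction hn : A.card + B.card using Nat.strong_induction_on generalizing G A B with
  | _ n ih =>
  have step : ∀ T : Finset V, 0 < (A ∩ T).card + (B ∩ T).card →
      ∑ a ∈ A \ T, (T.filter (G.Adj a)).card + ∑ a ∈ A ∩ T, (univ.filter (G.Adj a)).card ≤
        (2 * k - 1) * (A ∩ T).card + k * (B ∩ T).card →
      ∑ a ∈ A, (univ.filter (G.Adj a)).card ≤ (2 * k - 1) * A.card + k * B.card := by
    intro T hT hle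
    have hA := Finset.card_sdiff_add_card_inter A T
    have hB := Finset.card_sdiff_add_card_inter B T
    have := ih ((A \ T).card + (B \ T).card) (by omega) (G.isolate T) (A \ T) (B \ T)
      (hAB.mono Finset.sdiff_subset Finset.sdiff_subset)
      (fun u v h => by
        simp only [Finset.mem_sdiff]
        have := hcov u v h.1
        have := h.2
        tauto)
      (fun u v h => by
        simp only [Finset.mem_sdiff]
        have := hmem u v h.1
        have := h.2
        tauto)
      (fun x hx y hy s p => hno x (Finset.mem_sdiff.1 hx).1 y (Finset.mem_sdiff.1 hy).1 s
        (p.mono (G.isolate_le T))) rfl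
    rw [sum_card_neighbors_eq G A T, ← hA, ← hB, mul_add, mul_add]
    omega
  by_contra hlt
  have hA : A.Nonempty := by
    by_contra hA
    rw [Finset.not_nonempty_iff_eq_empty] at hA
    subst hA
    simp at hlt
  have hG : G.IsShortOddCover A k := by
    refine ⟨hcov, ?_, ?_, ?_⟩
    · intro b hb a hba
      by_contra! hdeg
      have hbB := (hmem b a hba).resolve_left hb
      refine hlt (step {b} ?_ ?_)
      · simp [Finset.inter_singleton_of_mem hbB]
      · rw [Finset.inter_singleton_of_mem hbB, Finset.inter_singleton_of_notMem hb]
        have h1 : ∑ a ∈ A \ {b}, (({b} : Finset V).filter (G.Adj a)).card =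
            ((A \ {b}).filter (G.Adj b)).card := by
          rw [Finset.card_filter]
          refine Finset.sum_congr rfl fun a _ => ?_
          rw [Finset.filter_singleton]
          simp only [G.adj_comm b a]
          split_ifs <;> simp
        have h2 := Finset.card_le_card
          (Finset.filter_subset_filter (G.Adj b) (Finset.subset_univ (A \ {b})))
        simp only [h1, Finset.sum_empty, Finset.card_empty, Finset.card_singleton]
        omega
    · intro b hb
      by_contra! hdeg
      have hbB : b ∉ B := Finset.disjoint_left.1 hAB hb
      refine hlt (step {b} ?_ ?_)
      · simp [Finset.inter_singleton_of_mem hb]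
      · rw [Finset.inter_singleton_of_mem hb, Finset.inter_singleton_of_notMem hbB]
        have h1 : ∑ a ∈ A \ {b}, (({b} : Finset V).filter (G.Adj a)).card =
            ((A \ {b}).filter (G.Adj b)).card := by
          rw [Finset.card_filter]
          refine Finset.sum_congr rfl fun a _ => ?_
          rw [Finset.filter_singleton]
          simp only [G.adj_comm b a]
          split_ifs <;> simp
        have h2 := Finset.card_le_card
          (Finset.filter_subset_filter (G.Adj b) (Finset.subset_univ (A \ {b})))
        simp only [h1, Finset.sum_singleton, Finset.card_empty, Finset.card_singleton]
        omega
    · intro x hx y hy s p hodd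
      by_contra! hs
      obtain ⟨x, hx, y, hy, t, q, ht⟩ := p.exists_of_odd hcov hx hy hodd hs
      exact hno x hx y hy t q ht
  obtain ⟨T, hTA, hTk, hT⟩ := hG.exists_closed hk hA
  rw [Finset.inter_comm] at hTA
  refine hlt (step T (by have := hTA.card_pos; omega) ?_)
  have h1 : ∑ a ∈ A \ T, (T.filter (G.Adj a)).card = 0 := by
    refine Finset.sum_eq_zero fun a ha => ?_
    rw [Finset.card_eq_zero, Finset.filter_eq_empty_iff]
    exact fun t ht h => hT t ht a (Finset.mem_sdiff.1 ha).2 h.symm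
  have h2 : ∑ a ∈ A ∩ T, (univ.filter (G.Adj a)).card ≤ ∑ a ∈ A ∩ T, (2 * k - 1) := by
    refine Finset.sum_le_sum fun a ha => ?_
    have haT := (Finset.mem_inter.1 ha).2
    have : univ.filter (G.Adj a) ⊆ T.erase a := by
      intro x hx
      have hax : G.Adj a x := (Finset.mem_filter.1 hx).2
      rw [Finset.mem_erase]
      exact ⟨hax.ne', by_contra fun h => hT a haT x h hax⟩
    have := Finset.card_le_card this
    rw [Finset.card_erase_of_mem haT] at this
    omega
  rw [Finset.sum_const, smul_eq_mul, mul_comm] at h2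
  omega

/-- The graph obtained from `G` by isolating `u` and keeping only the edges that meet the
neighbourhood of `u`. -/
def neighborCoverGraph {V : Type*} (G : SimpleGraph V) (u : V) : SimpleGraph V where
  Adj a b := G.Adj a b ∧ a ≠ u ∧ b ≠ u ∧ (G.Adj u a ∨ G.Adj u b)
  symm := ⟨fun _ _ h => ⟨h.1.symm, h.2.2.1, h.2.1, h.2.2.2.symm⟩⟩
  loopless := ⟨fun _ h => h.1.ne rfl⟩

theorem neighborCoverGraph_adj {V : Type*} {G : SimpleGraph V} {u a b : V} :
    (G.neighborCoverGraph u).Adj a b ↔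
      G.Adj a b ∧ a ≠ u ∧ b ≠ u ∧ (G.Adj u a ∨ G.Adj u b) := Iff.rfl

theorem neighborCoverGraph_le {V : Type*} (G : SimpleGraph V) (u : V) :
    G.neighborCoverGraph u ≤ G :=
  fun _ _ h => h.1

theorem SpanPath.notMem_of_neighborCoverGraph {V : Type*} {G : SimpleGraph V} {u x y : V}
    {s : Finset V} (p : (G.neighborCoverGraph u).SpanPath x y s) (hx : x ≠ u) : u ∉ s := by
  induction p with
  | single x => simpa using hx.symm
  | cons h hx' p ih =>
    rw [Finset.mem_cons, not_or]
    exact ⟨hx.symm, ih h.2.2.1⟩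

/-- In a graph without `C_{2k+2}`, the number of walks of length two starting at `u` is bounded. -/
theorem sum_degree_neighbors_le {V : Type*} [Fintype V] [DecidableEq V] (G : SimpleGraph V)
    [DecidableRel G.Adj] {k : ℕ} (hk : 1 ≤ k)
    (hC : ¬ ∃ (u : V) (c : G.Walk u u), c.IsCycle ∧ c.length = 2 * k + 2) (u : V) :
    ∑ v ∈ G.neighborFinset u, G.degree v ≤ k * G.degree u + k * (Fintype.card V - 1) := by
  classical
  have hle := sum_card_neighbors_le hk (G.neighborCoverGraph u) (G.neighborFinset u)
    (univ \ (insert u (G.neighborFinset u)))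
    (by
      rw [Finset.disjoint_left]
      intro x hx hx'
      exact (Finset.mem_sdiff.1 hx').2 (Finset.mem_insert_of_mem hx))
    (fun a b h => by simpa using h.2.2.2)
    (fun a b h => by
      have := h.2.1
      simp only [Finset.mem_sdiff, Finset.mem_univ, true_and, Finset.mem_insert]
      tauto)
    (fun x hx y hy s p hs => by
      rw [mem_neighborFinset] at hx hy
      obtain ⟨c, hc, hl⟩ := (p.mono (G.neighborCoverGraph_le u)).exists_cycle hx hy
        (p.notMem_of_neighborCoverGraph hx.ne') (by omega)
      exact hC ⟨u, c, hc, by omega⟩)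
  have hsum : ∑ v ∈ G.neighborFinset u, G.degree v =
      ∑ v ∈ G.neighborFinset u, ((univ.filter ((G.neighborCoverGraph u).Adj v)).card + 1) := by
    refine Finset.sum_congr rfl fun v hv => ?_
    rw [mem_neighborFinset] at hv
    rw [← card_neighborFinset_eq_degree, ← Finset.card_erase_add_one
      (show u ∈ G.neighborFinset v by simpa using hv.symm)]
    congr 2
    ext x
    simp only [Finset.mem_erase, mem_neighborFinset, Finset.mem_filter, Finset.mem_univ, true_and]
    rw [neighborCoverGraph_adj]
    have := hv.ne'
    tauto
  have hcard : (univ \ (insert u (G.neighborFinset u))).card + (G.degree u + 1) =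
      Fintype.card V := by
    rw [← card_neighborFinset_eq_degree, ← Finset.card_insert_of_notMem
      (show u ∉ G.neighborFinset u by simp), Finset.card_sdiff_add_card_eq_card
      (Finset.subset_univ _), Finset.card_univ]
  rw [hsum, Finset.sum_add_distrib, Finset.sum_const, card_neighborFinset_eq_degree]
  rw [card_neighborFinset_eq_degree] at hle
  generalize (univ \ (insert u (G.neighborFinset u))).card = b at hle hcard
  rw [← hcard, show b + (G.degree u + 1) - 1 = b + G.degree u by omega]
  obtain ⟨j, rfl⟩ : ∃ j, k = j + 1 := ⟨k - 1, by omega⟩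
  rw [show 2 * (j + 1) - 1 = 2 * j + 1 by omega] at hle
  simp only [smul_eq_mul, mul_one]
  nlinarith

end SimpleGraph

/-- Theorem 2. Let `k ≥ 1` and let `G` be a graph with `n` vertices and
`m` edges. If `G` contains no cycle of length `2k+2`, then
`∑_{u ∈ V(G)} d_G(u)² ≤ 2km + k(n−1)n`. -/
theorem degree_powers_stmt_2 {V : Type*} [Fintype V] [DecidableEq V]
    (G : SimpleGraph V) [DecidableRel G.Adj] (k : ℕ) (hk : 1 ≤ k)
    (hC : ¬ ∃ (u : V) (c : G.Walk u u), c.IsCycle ∧ c.length = 2 * k + 2) :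
    ∑ u : V, G.degree u ^ 2
      ≤ 2 * k * G.edgeFinset.card + k * (Fintype.card V - 1) * Fintype.card V := by
  classical
  have h1 : ∑ u : V, G.degree u ^ 2 = ∑ u : V, ∑ v ∈ G.neighborFinset u, G.degree v := by
    have h2 : ∀ u : V, ∑ v ∈ G.neighborFinset u, G.degree v =
        ∑ v : V, if G.Adj u v then G.degree v else 0 := by
      intro u
      rw [SimpleGraph.neighborFinset_eq_filter, Finset.sum_filter]
    simp only [h2]
    rw [Finset.sum_comm]
    refine Finset.sum_congr rfl fun v _ => ?_
    rw [← Finset.sum_filter, Finset.sum_const, sq, smul_eq_mul]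
    congr 1
    rw [← SimpleGraph.card_neighborFinset_eq_degree, SimpleGraph.neighborFinset_eq_filter]
    simp only [G.adj_comm v]
  calc ∑ u : V, G.degree u ^ 2
      ≤ ∑ u : V, (k * G.degree u + k * (Fintype.card V - 1)) := by
        rw [h1]
        exact Finset.sum_le_sum fun u _ => G.sum_degree_neighbors_le hk hC u
    _ = 2 * k * G.edgeFinset.card + k * (Fintype.card V - 1) * Fintype.card V := by
        rw [Finset.sum_add_distrib, ← Finset.mul_sum, G.sum_degrees_eq_twice_card_edges,
          Finset.sum_const, Finset.card_univ, smul_eq_mul]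
        ring
end

section
/- Let k ≥ 1 be an integer, let p ≥ 2 be a real number, and let G be a finite simple graph with n vertices containing no cycle of length 2k+2. Then the sum over all vertices u of G of d_G(u)^p is at most k·n^p + 2·(k·n)^{3/2}·n^{p−2}. -/
/-- The first `p` terms of `v` are distinct, lie in `W`, and are consecutively adjacent in `H`. -/
structure PathSeq {V : Type*} (H : SimpleGraph V) (W : Finset V) (v : ℕ → V) (p : ℕ) : Prop where
  mem : ∀ i, i < p → v i ∈ W
  inj : ∀ i j, i < p → j < p → v i = v j → i = j
  adj : ∀ i, i + 1 < p → H.Adj (v i) (v (i + 1))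

namespace PathSeq

variable {V : Type*} {H : SimpleGraph V} {W : Finset V} {v : ℕ → V} {p : ℕ}

theorem mono {W' : Finset V} (h : PathSeq H W v p) (hW : W ⊆ W') : PathSeq H W' v p :=
  ⟨fun i hi => hW (h.mem i hi), h.inj, h.adj⟩

theorem adj_of_eq (h : PathSeq H W v p) {i j : ℕ} (hj : j < p) (hij : j = i + 1) :
    H.Adj (v i) (v j) := by
  subst hij
  exact h.adj i hj

theorem window (h : PathSeq H W v p) {s q : ℕ} (hs : s + q ≤ p) :
    PathSeq H W (fun i => v (s + i)) q where
  mem i hi := h.mem _ (by omega)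
  inj i j hi hj e := by
    have := h.inj _ _ (by omega) (by omega) e
    omega
  adj i hi := h.adj_of_eq (by omega) (by omega)

theorem reverse (h : PathSeq H W v p) : PathSeq H W (fun i => v (p - 1 - i)) p where
  mem i hi := h.mem _ (by omega)
  inj i j hi hj e := by
    have := h.inj _ _ (by omega) (by omega) e
    omega
  adj i hi := (h.adj_of_eq (by omega) (by omega)).symm

theorem rotate (h : PathSeq H W v p) {j : ℕ} (hj : j < p) (ha : H.Adj (v 0) (v j)) :
    PathSeq H W (fun i => if i < j then v (j - 1 - i) else v i) p where
  mem i hi := by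
    split_ifs <;> exact h.mem _ (by omega)
  inj i l hi hl e := by
    split_ifs at e <;> have := h.inj _ _ (by omega) (by omega) e <;> omega
  adj i hi := by
    split_ifs with h1 h2 h2
    · exact (h.adj_of_eq (by omega) (by omega)).symm
    · have e1 : j - 1 - i = 0 := by omega
      have e2 : i + 1 = j := by omega
      rwa [e1, e2]
    · omega
    · exact h.adj i hi

theorem cons (h : PathSeq H W v p) {w : V} (hw : w ∈ W) (hn : ∀ i, i < p → v i ≠ w)
    (ha : H.Adj w (v 0)) : PathSeq H W (fun i => if i = 0 then w else v (i - 1)) (p + 1) where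
  mem i hi := by
    split_ifs
    · exact hw
    · exact h.mem _ (by omega)
  inj i j hi hj e := by
    split_ifs at e
    · omega
    · exact absurd e.symm (hn _ (by omega))
    · exact absurd e (hn _ (by omega))
    · have := h.inj _ _ (by omega) (by omega) e
      omega
  adj i hi := by
    rw [if_neg (Nat.succ_ne_zero i)]
    split_ifs with h1
    · subst h1
      exact ha
    · exact h.adj_of_eq (by omega) (by omega)

theorem cyclicShift (h : PathSeq H W v p) (ha : H.Adj (v (p - 1)) (v 0)) (hp : 0 < p) (s : ℕ) :
    PathSeq H W (fun i => v ((s + i) % p)) p where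
  mem i hi := h.mem _ (Nat.mod_lt _ hp)
  inj i j hi hj e := by
    have e' : s + i ≡ s + j [MOD p] := h.inj _ _ (Nat.mod_lt _ hp) (Nat.mod_lt _ hp) e
    exact (Nat.ModEq.add_left_cancel' s e').eq_of_lt_of_lt hi hj
  adj i hi := by
    have hlt := Nat.mod_lt (s + i) hp
    rw [← add_assoc, ← Nat.mod_add_mod (s + i) p 1]
    by_cases hc : (s + i) % p + 1 < p
    · rw [Nat.mod_eq_of_lt hc]
      exact h.adj _ hc
    · have e1 : (s + i) % p = p - 1 := by omega
      have e2 : (s + i) % p + 1 = p := by omega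
      rw [e2, Nat.mod_self, e1]
      exact ha

theorem crossing (h : PathSeq H W v p) {j : ℕ} (ha : H.Adj (v (p - 1)) (v j)) :
    PathSeq H W (fun i => if i ≤ j then v i else v (p + j - i)) p where
  mem i hi := by
    split_ifs <;> exact h.mem _ (by omega)
  inj i l hi hl e := by
    split_ifs at e <;> have := h.inj _ _ (by omega) (by omega) e <;> omega
  adj i hi := by
    split_ifs with h1 h2 h2
    · exact h.adj i hi
    · have e1 : i = j := by omega
      have e2 : p + j - (i + 1) = p - 1 := by omega
      rw [e2, e1]
      exact ha.symm
    · omega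
    · exact (h.adj_of_eq (by omega) (by omega)).symm

theorem exists_walk {v : ℕ → V} : ∀ {p : ℕ}, PathSeq H W v (p + 1) →
    ∃ w : H.Walk (v 0) (v p), w.IsPath ∧ w.length = p ∧ ∀ x ∈ w.support, ∃ i ≤ p, x = v i
  | 0, _ => ⟨.nil, by simp, rfl, by simp⟩
  | p + 1, h => by
    have h' : PathSeq H W v (p + 1) := by
      simpa only [zero_add] using h.window (s := 0) (q := p + 1) (by omega)
    obtain ⟨w, hw, hl, hs⟩ := exists_walk h'
    refine ⟨w.concat (h.adj p (by omega)), ?_, ?_, ?_⟩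
    · refine hw.concat (fun hm => ?_) _
      obtain ⟨i, hi, e⟩ := hs _ hm
      have := h.inj _ _ (by omega) (by omega) e
      omega
    · simp [hl]
    · intro x hx
      rw [SimpleGraph.Walk.support_concat, List.mem_append] at hx
      rcases hx with hx | hx
      · obtain ⟨i, hi, e⟩ := hs _ hx
        exact ⟨i, by omega, e⟩
      · exact ⟨p + 1, le_rfl, by simpa using hx⟩

variable {A : Finset V} {k : ℕ}

theorem closed_lt (h : PathSeq H W v p) (ha : H.Adj (v (p - 1)) (v 0)) (hk : 1 ≤ k)
    (hB : ∀ x y, H.Adj x y → x ∈ A ∨ y ∈ A)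
    (hno : ∀ v, PathSeq H W v (2 * k + 1) → v 0 ∈ A → v (2 * k) ∉ A) : p ≤ 2 * k := by
  by_contra! hp
  have hw : ∀ s, v (s % p) ∈ A → v ((s + 2 * k) % p) ∉ A := fun s hs => by
    have h1 := (h.cyclicShift ha (by omega) s).window (s := 0) (q := 2 * k + 1) (by omega)
    simpa using hno _ h1 (by simpa using hs)
  have hadj : ∀ s, v (s % p) ∈ A ∨ v ((s + 1) % p) ∈ A := fun s =>
    hB _ _ ((h.cyclicShift ha (by omega) s).adj 0 (by omega))
  have hstep : ∀ s, v (s % p) ∈ A → v ((s + 1) % p) ∉ A := fun s h0 h1 => by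
    rcases hadj (s + 2 * k) with h2 | h2
    · exact hw s h0 h2
    · exact hw (s + 1) h1 (by rwa [show s + 1 + 2 * k = s + 2 * k + 1 by ring])
  have heven : ∀ s, v (s % p) ∈ A → ∀ t, v ((s + 2 * t) % p) ∈ A := fun s hs t => by
    induction t with
    | zero => exact hs
    | succ t ih => exact (hadj (s + 2 * t + 1)).resolve_left (hstep _ ih)
  rcases hadj 0 with h0 | h0
  · exact hw 0 h0 (heven 0 h0 k)
  · exact hw 1 h0 (heven 1 h0 k)

theorem alternates (h : PathSeq H W v p) (hk : 1 ≤ k) (hp : 2 * k + 1 ≤ p)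
    (hB : ∀ x y, H.Adj x y → x ∈ A ∨ y ∈ A)
    (hno : ∀ v, PathSeq H W v (2 * k + 1) → v 0 ∈ A → v (2 * k) ∉ A)
    (h0 : v 0 ∈ A) (h1 : v (p - 1) ∈ A) : Even p ∧ v 1 ∉ A ∧ v (2 * k - 1) ∈ A := by
  have hw : ∀ s, s + 2 * k < p → v s ∈ A → v (s + 2 * k) ∉ A := fun s hs hA =>
    hno _ (h.window (s := s) (q := 2 * k + 1) (by omega)) hA
  have hadj : ∀ s, s + 1 < p → v s ∈ A ∨ v (s + 1) ∈ A := fun s hs => hB _ _ (h.adj s hs)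
  have hlt : ∀ s, s < p → v s ∉ A → s + 1 < p := fun s hs hA => by
    by_contra hc
    exact hA (by rwa [show s = p - 1 by omega])
  have key : ∀ t, 2 * t + 2 * k < p → v (2 * t) ∈ A := fun t => by
    induction t with
    | zero => exact fun _ => h0
    | succ t ih =>
      intro ht
      have h2 := hw (2 * t) (by omega) (ih (by omega))
      have h3 := (hadj _ (by omega)).resolve_left h2
      have h4 : v (2 * t + 1) ∉ A := fun hc =>
        hw (2 * t + 1) (by omega) hc (by rwa [show 2 * t + 1 + 2 * k = 2 * t + 2 * k + 1 by ring])
      exact (hadj (2 * t + 1) (by omega)).resolve_left h4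
  refine ⟨?_, ?_, ?_⟩
  · by_contra hodd
    obtain ⟨m, hm⟩ := Nat.not_even_iff_odd.mp hodd
    refine hw (2 * (m - k)) (by omega) (key _ (by omega)) ?_
    rwa [show 2 * (m - k) + 2 * k = p - 1 by omega]
  · have h2 := hw 0 (by omega) h0
    have h3 := hlt _ (by omega) h2
    have h4 := (hadj _ h3).resolve_left h2
    intro hc
    exact hw 1 (by omega) hc (by rwa [show 1 + 2 * k = 0 + 2 * k + 1 by ring])
  · have h2 := hw 0 (by omega) h0
    rw [zero_add] at h2
    have h3 := hadj (2 * k - 1) (by omega)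
    rw [show 2 * k - 1 + 1 = 2 * k by omega] at h3
    exact h3.resolve_right h2

theorem exists_eq_of_adj (h : PathSeq H W v p) (hmax : ∀ v, ¬PathSeq H W v (p + 1))
    {x : V} (hx : x ∈ W) (ha : H.Adj (v 0) x) : ∃ j, 0 < j ∧ j < p ∧ v j = x := by
  by_contra! hc
  refine hmax _ (h.cons hx (fun i hi e => ?_) ha.symm)
  rcases Nat.eq_zero_or_pos i with rfl | hi0
  · exact ha.ne e
  · exact hc i hi0 hi e

end PathSeq

open Classical in
/-- The number of neighbours of `u` in `W`. -/
noncomputable def degIn {V : Type*} (H : SimpleGraph V) (W : Finset V) (u : V) : ℕ :=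
  (W.filter (H.Adj u)).card

section DegIn

variable {V : Type*} {H : SimpleGraph V} {W A : Finset V} {k : ℕ}

open Classical in
theorem degIn_erase {x : V} (hx : x ∈ W) (u : V) :
    degIn H W u = degIn H (W.erase x) u + if H.Adj u x then 1 else 0 := by
  unfold degIn
  rw [Finset.filter_erase]
  split_ifs with h
  · exact (Finset.card_erase_add_one (Finset.mem_filter.mpr ⟨hx, h⟩)).symm
  · rw [Finset.erase_eq_of_notMem (by simp [h]), add_zero]

theorem degIn_mono {W' : Finset V} (h : W ⊆ W') (u : V) : degIn H W u ≤ degIn H W' u := by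
  classical
  exact Finset.card_le_card (Finset.filter_subset_filter _ h)

open Classical in
theorem sum_degIn_erase {x : V} (hx : x ∈ W) (S : Finset V) :
    ∑ u ∈ S, degIn H W u = ∑ u ∈ S, degIn H (W.erase x) u + degIn H S x := by
  simp_rw [degIn_erase hx]
  rw [Finset.sum_add_distrib, Finset.sum_boole]
  simp only [degIn, SimpleGraph.adj_comm, Nat.cast_id]

open Classical in
theorem sum_degIn_of_notMem {x : V} (hx : x ∈ W) (hA : x ∉ A)
    (hB : ∀ x y, H.Adj x y → x ∈ A ∨ y ∈ A) :
    ∑ u ∈ W with u ∈ A, degIn H W u =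
      ∑ u ∈ W.erase x with u ∈ A, degIn H (W.erase x) u + degIn H W x := by
  have hx' : x ∉ W.filter (· ∈ A) := by simp [hA]
  rw [sum_degIn_erase hx, Finset.filter_erase, Finset.erase_eq_of_notMem hx']
  congr 1
  unfold degIn
  congr 1
  ext y
  simp only [Finset.mem_filter]
  have := hB x y
  tauto

open Classical in
theorem sum_degIn_of_mem {x : V} (hx : x ∈ W) (hA : x ∈ A) :
    ∑ u ∈ W with u ∈ A, degIn H W u =
      ∑ u ∈ W.erase x with u ∈ A, degIn H (W.erase x) u + degIn H W x
        + degIn H (W.filter (· ∈ A)) x := by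
  have hx' : x ∈ W.filter (· ∈ A) := by simp [hx, hA]
  have h0 := degIn_erase (H := H) hx' x
  rw [if_neg (H.irrefl), add_zero] at h0
  rw [← Finset.sum_erase_add _ _ hx', sum_degIn_erase hx, Finset.filter_erase, h0]
  ring

end DegIn

/-- A size bound for a set `J ⊆ [1, m - 1]` without two consecutive elements. -/
theorem two_mul_card_add_card_le {m : ℕ} {J K : Finset ℕ} (hJ : ∀ j ∈ J, 1 ≤ j ∧ j + 1 ≤ m)
    (hK : K ⊆ J) (h1 : ∀ j ∈ J, j + 1 ∉ J) (h2 : ∀ j ∈ K, j + 2 ∉ J) :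
    2 * J.card + K.card ≤ m + 1 := by
  classical
  have hd1 : Disjoint J (J.map (addRightEmbedding 1)) := by
    rw [Finset.disjoint_left]
    intro j hj hj'
    obtain ⟨i, hi, rfl⟩ := Finset.mem_map.mp hj'
    exact h1 i hi hj
  have hd2 : Disjoint (J ∪ J.map (addRightEmbedding 1)) (K.map (addRightEmbedding 2)) := by
    rw [Finset.disjoint_left]
    intro j hj hj'
    obtain ⟨i, hi, rfl⟩ := Finset.mem_map.mp hj'
    rcases Finset.mem_union.mp hj with hj | hj
    · exact h2 i hi hj
    · obtain ⟨l, hl, e⟩ := Finset.mem_map.mp hj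
      simp only [addRightEmbedding_apply] at e
      exact h1 i (hK hi) (by rwa [show i + 1 = l by omega])
  have hc := Finset.card_union_of_disjoint hd2
  rw [Finset.card_union_of_disjoint hd1, Finset.card_map, Finset.card_map] at hc
  have hs : (J ∪ J.map (addRightEmbedding 1)) ∪ K.map (addRightEmbedding 2) ⊆
      Finset.Icc 1 (m + 1) := by
    intro j hj
    simp only [Finset.mem_union, Finset.mem_map, addRightEmbedding_apply] at hj
    rw [Finset.mem_Icc]
    rcases hj with (hj | ⟨i, hi, rfl⟩) | ⟨i, hi, rfl⟩
    · have := hJ j hj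
      omega
    · have := hJ i hi
      omega
    · have := hJ i (hK hi)
      omega
  have := Finset.card_le_card hs
  rw [Nat.card_Icc] at this
  omega

section MaximalPath

variable {V : Type*} {H : SimpleGraph V} {W A : Finset V} {k p : ℕ} {v : ℕ → V}

open Classical in
theorem PathSeq.degIn_le_card (h : PathSeq H W v p) (hmax : ∀ v, ¬PathSeq H W v (p + 1))
    {S : Finset V} (hS : S ⊆ W) :
    degIn H S (v 0) ≤ ((Finset.range p).filter
      fun j => 0 < j ∧ H.Adj (v 0) (v j) ∧ v j ∈ S).card := by
  refine (Finset.card_le_card ?_).trans (Finset.card_image_le (f := v))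
  intro x hx
  obtain ⟨hx, ha⟩ := Finset.mem_filter.mp hx
  obtain ⟨j, h0, hj, rfl⟩ := h.exists_eq_of_adj hmax (hS hx) ha
  exact Finset.mem_image.mpr ⟨j, by simp [*], rfl⟩

theorem PathSeq.degIn_add_degIn_lt (h : PathSeq H W v p) (hp : 0 < p)
    (hmax : ∀ v, ¬PathSeq H W v (p + 1))
    (hopen : ∀ v, PathSeq H W v p → ¬H.Adj (v (p - 1)) (v 0)) :
    degIn H W (v 0) + degIn H W (v (p - 1)) < p := by
  classical
  have h0 := h.degIn_le_card hmax subset_rfl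
  have h1 := h.reverse.degIn_le_card hmax subset_rfl
  rw [Nat.sub_zero] at h1
  set J := (Finset.range p).filter fun j => 0 < j ∧ H.Adj (v 0) (v j) ∧ v j ∈ W with hJ
  set K := (Finset.range p).filter
    fun j => 0 < j ∧ H.Adj (v (p - 1)) (v (p - 1 - j)) ∧ v (p - 1 - j) ∈ W with hK
  have hinj : Set.InjOn (fun j => p - j) K := by
    intro i hi j hj e
    simp only [hK, Finset.coe_filter, Finset.mem_range, Set.mem_ofPred_eq] at hi hj e
    omega
  have hd : Disjoint J (K.image fun j => p - j) := by
    rw [Finset.disjoint_left]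
    intro j hj hj'
    obtain ⟨i, hi, rfl⟩ := Finset.mem_image.mp hj'
    simp only [hJ, hK, Finset.mem_filter, Finset.mem_range] at hi hj
    refine hopen _ (h.crossing hi.2.2.1) ?_
    rw [if_neg (by omega), if_pos (Nat.zero_le _)]
    rw [show p + (p - 1 - i) - (p - 1) = p - i by omega]
    exact hj.2.2.1.symm
  have hs : J ∪ K.image (fun j => p - j) ⊆ Finset.Ico 1 p := by
    intro j hj
    simp only [hJ, hK, Finset.mem_union, Finset.mem_image, Finset.mem_filter,
      Finset.mem_range] at hj
    rw [Finset.mem_Ico]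
    rcases hj with hj | ⟨i, hi, rfl⟩ <;> omega
  have hc := Finset.card_le_card hs
  rw [Finset.card_union_of_disjoint hd, Finset.card_image_of_injOn hinj, Nat.card_Ico] at hc
  omega

theorem PathSeq.lt_of_adj (h : PathSeq H W v p) (hk : 1 ≤ k)
    (hB : ∀ x y, H.Adj x y → x ∈ A ∨ y ∈ A)
    (hno : ∀ v, PathSeq H W v (2 * k + 1) → v 0 ∈ A → v (2 * k) ∉ A)
    {j : ℕ} (hj : j < p) (ha : H.Adj (v 0) (v j)) : j + 1 ≤ 2 * k := by
  have h1 := h.window (s := 0) (q := j + 1) (by omega)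
  simp only [zero_add] at h1
  exact h1.closed_lt ha.symm hk hB hno

theorem PathSeq.first_mem (h : PathSeq H W v p) (hk : 1 ≤ k)
    (hmax : ∀ v, ¬PathSeq H W v (p + 1))
    (hB : ∀ x y, H.Adj x y → x ∈ A ∨ y ∈ A)
    (hno : ∀ v, PathSeq H W v (2 * k + 1) → v 0 ∈ A → v (2 * k) ∉ A)
    (hdeg : ∀ x ∈ W, x ∉ A → k + 1 ≤ degIn H W x)
    (hp : v 0 ∉ A → 2 * k + 2 ≤ p) (hp' : v 0 ∉ A → v (p - 1) ∉ A → 2 * k + 3 ≤ p) :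
    v 0 ∈ A := by
  classical
  by_contra h0
  have hp1 := hp h0
  have h1 : v 1 ∈ A := (hB _ _ (h.adj 0 (by omega))).resolve_left h0
  obtain ⟨e, he, hep, heA⟩ : ∃ e, 2 * k + 1 ≤ e ∧ e + 1 ≤ p ∧ v e ∈ A := by
    by_cases hl : v (p - 1) ∈ A
    · exact ⟨p - 1, by omega, by omega, hl⟩
    · have hp2 := hp' h0 hl
      have ha := hB _ _ (h.adj (p - 2) (by omega))
      rw [show p - 2 + 1 = p - 1 by omega] at ha
      exact ⟨p - 2, by omega, by omega, ha.resolve_right hl⟩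
  have heven : Even e := by
    refine ((h.window (s := 1) (q := e) (by omega)).alternates hk he hB hno h1 ?_).1
    rwa [show 1 + (e - 1) = e by omega]
  have hc := (hdeg _ (h.mem 0 (by omega)) h0).trans (h.degIn_le_card hmax subset_rfl)
  set J := (Finset.range p).filter fun j => 0 < j ∧ H.Adj (v 0) (v j) ∧ v j ∈ W with hJ
  have hJ1 : ∀ j ∈ J, 1 ≤ j ∧ j + 1 ≤ 2 * k := by
    intro j hj
    simp only [hJ, Finset.mem_filter, Finset.mem_range] at hj
    exact ⟨hj.2.1, h.lt_of_adj hk hB hno hj.1 hj.2.2.1⟩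
  have hJ2 : ∀ j ∈ J, j + 1 ∉ J := by
    intro j hj hj'
    have hj1 := hJ1 j hj
    simp only [hJ, Finset.mem_filter, Finset.mem_range] at hj hj'
    have hr := (h.rotate hj'.1 hj'.2.2.1).window (s := 0) (q := e + 1) (by omega)
    simp only [zero_add] at hr
    have hodd := (hr.alternates hk (by omega) hB hno ?_ ?_).1
    · exact (Nat.even_add_one.mp hodd) heven
    · rw [if_pos (by omega)]
      exact (hB _ _ hj.2.2.1).resolve_left h0
    · rw [if_neg (by omega)]
      exact heA
  have := two_mul_card_add_card_le hJ1 (Finset.empty_subset J) hJ2 (by simp)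
  rw [Finset.card_empty] at this
  omega

open Classical in
theorem PathSeq.false_of_maximal (h : PathSeq H W v p) (hp0 : 0 < p) (hk : 1 ≤ k)
    (hmax : ∀ v, ¬PathSeq H W v (p + 1))
    (hB : ∀ x y, H.Adj x y → x ∈ A ∨ y ∈ A)
    (hno : ∀ v, PathSeq H W v (2 * k + 1) → v 0 ∈ A → v (2 * k) ∉ A)
    (hopen : ∀ v, PathSeq H W v p → ¬H.Adj (v (p - 1)) (v 0))
    (hdegB : ∀ x ∈ W, x ∉ A → k + 1 ≤ degIn H W x)
    (hdegA : ∀ x ∈ W, x ∈ A → 2 * k ≤ degIn H W x + degIn H {x ∈ W | x ∈ A} x) : False := by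
  have hdeg : ∀ x ∈ W, k ≤ degIn H W x := by
    intro x hx
    by_cases hA : x ∈ A
    · have h1 := hdegA x hx hA
      have h2 := degIn_mono (H := H) (Finset.filter_subset (· ∈ A) W) x
      omega
    · exact (Nat.le_succ k).trans (hdegB x hx hA)
  have hfirst : ∀ v, PathSeq H W v p → v 0 ∈ A := by
    intro v h
    have h1 := h.degIn_add_degIn_lt hp0 hmax hopen
    have h2 := hdegB _ (h.mem 0 hp0)
    have h3 := hdegB _ (h.mem (p - 1) (by omega))
    have h4 := hdeg _ (h.mem (p - 1) (by omega))
    refine h.first_mem hk hmax hB hno hdegB (fun hA => ?_) (fun hA hA' => ?_)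
    · have := h2 hA
      omega
    · have := h2 hA
      have := h3 hA'
      omega
  have hlast : ∀ v, PathSeq H W v p → v (p - 1) ∈ A := fun v h => hfirst _ h.reverse
  have hp : 2 * k + 1 ≤ p := by
    have h1 := h.degIn_add_degIn_lt hp0 hmax hopen
    have h2 := hdeg _ (h.mem 0 hp0)
    have h4 := hdeg _ (h.mem (p - 1) (by omega))
    omega
  have halt : ∀ v, PathSeq H W v p → Even p ∧ v 1 ∉ A ∧ v (2 * k - 1) ∈ A := fun v h =>
    h.alternates hk hp hB hno (hfirst v h) (hlast v h)
  have hc1 := h.degIn_le_card hmax subset_rfl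
  have hc2 := h.degIn_le_card hmax (Finset.filter_subset (· ∈ A) W)
  have hc3 := hdegA _ (h.mem 0 hp0) (hfirst v h)
  set J := (Finset.range p).filter fun j => 0 < j ∧ H.Adj (v 0) (v j) ∧ v j ∈ W with hJ
  set K := (Finset.range p).filter
    fun j => 0 < j ∧ H.Adj (v 0) (v j) ∧ v j ∈ {x ∈ W | x ∈ A} with hK
  have hJ1 : ∀ j ∈ J, 1 ≤ j ∧ j + 1 ≤ 2 * k := by
    intro j hj
    simp only [hJ, Finset.mem_filter, Finset.mem_range] at hj
    exact ⟨hj.2.1, h.lt_of_adj hk hB hno hj.1 hj.2.2.1⟩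
  have hKJ : K ⊆ J := by
    intro j hj
    simp only [hJ, hK, Finset.mem_filter, Finset.mem_range] at hj ⊢
    tauto
  have hpred : ∀ j ∈ J, v (j - 1) ∈ A := by
    intro j hj
    simp only [hJ, Finset.mem_filter, Finset.mem_range] at hj
    simpa [hj.2.1] using hfirst _ (h.rotate hj.1 hj.2.2.1)
  have hpred2 : ∀ j ∈ J, 2 ≤ j → v (j - 2) ∉ A := by
    intro j hj h2
    simp only [hJ, Finset.mem_filter, Finset.mem_range] at hj
    have := (halt _ (h.rotate hj.1 hj.2.2.1)).2.1
    rw [if_pos (by omega)] at this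
    rwa [show j - 2 = j - 1 - 1 by omega]
  have hJ2 : ∀ j ∈ J, j + 1 ∉ J := by
    intro j hj hj'
    have := hJ1 j hj
    refine hpred2 _ hj' (by omega) ?_
    rw [show j + 1 - 2 = j - 1 by omega]
    exact hpred j hj
  have hK2 : ∀ j ∈ K, j + 2 ∉ J := by
    intro j hj hj'
    refine hpred2 _ hj' (by omega) ?_
    simp only [hK, Finset.mem_filter] at hj
    exact hj.2.2.2.2
  have hfin := two_mul_card_add_card_le hJ1 hKJ hJ2 hK2
  have hle := Finset.card_le_card hKJ
  have hk1 : k = 1 := by omega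
  subst hk1
  exact (halt v h).2.1 (halt v h).2.2

end MaximalPath

section SumBound

variable {V : Type*} {H : SimpleGraph V} {A : Finset V} {k : ℕ}

theorem PathSeq.le_card {W : Finset V} {p : ℕ} {v : ℕ → V} (h : PathSeq H W v p) :
    p ≤ W.card := by
  have := Finset.card_le_card_of_injOn (s := Finset.range p) (t := W) v
    (fun i hi => h.mem i (by simpa using hi))
    (fun i hi j hj e => h.inj i j (by simpa using hi) (by simpa using hj) e)
  simpa using this

theorem exists_maximal_pathSeq {W : Finset V} (hW : W.Nonempty) :
    ∃ p v, 0 < p ∧ PathSeq H W v p ∧ ∀ v, ¬PathSeq H W v (p + 1) := by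
  classical
  obtain ⟨x, hx⟩ := hW
  have h1 : ∃ v, PathSeq H W v 1 :=
    ⟨fun _ => x, fun _ _ => hx, fun i j hi hj _ => by omega, fun i hi => by omega⟩
  have hc : 1 ≤ W.card := h1.choose_spec.le_card
  obtain ⟨v, hv⟩ := Nat.findGreatest_spec (P := fun p => ∃ v, PathSeq H W v p) hc h1
  refine ⟨_, v, Nat.le_findGreatest hc h1, hv, fun v' hv' => ?_⟩
  exact Nat.findGreatest_is_greatest (Nat.lt_succ_self _) hv'.le_card ⟨v', hv'⟩

open Classical in
/-- Deleting a set `T` closed under adjacency in `W`, when every vertex of `T` has few neighbours. -/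
theorem sum_degIn_le_sdiff {W T : Finset V} {m : ℕ} (hT : T ⊆ W) (hm : T.card ≤ m + 1)
    (hcl : ∀ u ∈ T, ∀ y ∈ W, H.Adj u y → y ∈ T) :
    ∑ u ∈ W with u ∈ A, degIn H W u ≤
      ∑ u ∈ W \ T with u ∈ A, degIn H (W \ T) u + m * (T.filter (· ∈ A)).card := by
  have hsplit : W.filter (· ∈ A) = (W \ T).filter (· ∈ A) ∪ T.filter (· ∈ A) := by
    rw [← Finset.filter_union, Finset.sdiff_union_of_subset hT]
  have hdisj : Disjoint ((W \ T).filter (· ∈ A)) (T.filter (· ∈ A)) :=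
    Finset.disjoint_filter_filter Finset.sdiff_disjoint
  rw [hsplit, Finset.sum_union hdisj]
  refine add_le_add (Finset.sum_le_sum fun u hu => ?_) ?_
  · simp only [Finset.mem_filter, Finset.mem_sdiff] at hu
    refine Finset.card_le_card fun y hy => ?_
    simp only [Finset.mem_filter, Finset.mem_sdiff] at hy ⊢
    exact ⟨⟨hy.1, fun hyT => hu.1.2 (hcl y hyT u hu.1.1 hy.2.symm)⟩, hy.2⟩
  · rw [mul_comm]
    refine Finset.sum_le_card_nsmul _ _ _ fun u hu => ?_
    have huT := (Finset.mem_filter.mp hu).1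
    have h1 : degIn H W u ≤ (T.erase u).card := by
      refine Finset.card_le_card fun y hy => ?_
      obtain ⟨hy, ha⟩ := Finset.mem_filter.mp hy
      exact Finset.mem_erase.mpr ⟨ha.ne', hcl u huT y hy ha⟩
    rw [Finset.card_erase_of_mem huT] at h1
    omega

open Classical in
/-- If no path on `2 * k + 1` vertices in `W` has both ends in the vertex cover `A`, then the degrees
of the vertices in `A` have a small sum. -/
theorem sum_degIn_le (hk : 1 ≤ k) (hB : ∀ x y, H.Adj x y → x ∈ A ∨ y ∈ A) (W : Finset V)
    (hno : ∀ v, PathSeq H W v (2 * k + 1) → v 0 ∈ A → v (2 * k) ∉ A) :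
    ∑ u ∈ W with u ∈ A, degIn H W u ≤
      (2 * k - 1) * (W.filter (· ∈ A)).card + k * (W.filter (· ∉ A)).card := by
  induction W using Finset.strongInduction with
  | H W ih =>
  replace ih := fun W' (h : W' ⊂ W) => ih W' h fun v hv => hno v (hv.mono h.1)
  by_contra! hlt
  have hW : W.Nonempty := by
    rw [Finset.nonempty_iff_ne_empty]
    rintro rfl
    simp at hlt
  obtain ⟨p, v, hp, hv, hmax⟩ := exists_maximal_pathSeq (H := H) hW
  refine hv.false_of_maximal hp hk hmax hB hno (fun v hv ha => ?_) (fun x hx hA => ?_)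
    (fun x hx hA => ?_)
  · have hpk := hv.closed_lt ha hk hB hno
    set T := (Finset.range p).image v with hT
    have hTW : T ⊆ W := by
      intro x hx
      obtain ⟨i, hi, rfl⟩ := Finset.mem_image.mp hx
      exact hv.mem i (by simpa using hi)
    have hTc : T.card ≤ 2 * k - 1 + 1 := by
      have : T.card ≤ (Finset.range p).card := Finset.card_image_le
      rw [Finset.card_range] at this
      omega
    have h0T : v 0 ∈ T := Finset.mem_image_of_mem _ (by simpa using hp)
    have h1 := sum_degIn_le_sdiff (H := H) (A := A) hTW hTc (by
      intro u hu y hy hadj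
      obtain ⟨i, hi, rfl⟩ := Finset.mem_image.mp hu
      have hi' : i < p := by simpa using hi
      obtain ⟨j, -, -, rfl⟩ := (hv.cyclicShift ha hp i).exists_eq_of_adj hmax hy
        (by simpa [Nat.mod_eq_of_lt hi'] using hadj)
      exact Finset.mem_image_of_mem _ (by simpa using Nat.mod_lt _ hp))
    have h2 := ih (W \ T) (Finset.sdiff_ssubset hTW ⟨_, h0T⟩)
    have h3 : (W.filter (· ∈ A)).card =
        ((W \ T).filter (· ∈ A)).card + (T.filter (· ∈ A)).card := by
      rw [← Finset.card_union_of_disjoint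
        (Finset.disjoint_filter_filter Finset.sdiff_disjoint), ← Finset.filter_union,
        Finset.sdiff_union_of_subset hTW]
    have h4 : ((W \ T).filter (· ∉ A)).card ≤ (W.filter (· ∉ A)).card :=
      Finset.card_le_card (Finset.filter_subset_filter _ Finset.sdiff_subset)
    have h5 := Nat.mul_le_mul_left k h4
    rw [h3, mul_add] at hlt
    omega
  · have h1 := ih (W.erase x) (Finset.erase_ssubset hx)
    rw [sum_degIn_of_notMem hx hA hB] at hlt
    have hx1 : x ∉ W.filter (· ∈ A) := by simp [hA]
    have hx2 : x ∈ W.filter (· ∉ A) := by simp [hx, hA]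
    rw [Finset.filter_erase (· ∉ A), Finset.filter_erase, Finset.erase_eq_of_notMem hx1] at h1
    rw [← Finset.card_erase_add_one hx2, mul_add, mul_one] at hlt
    rw [Finset.filter_erase, Finset.erase_eq_of_notMem hx1] at hlt
    omega
  · have h1 := ih (W.erase x) (Finset.erase_ssubset hx)
    rw [sum_degIn_of_mem hx hA] at hlt
    have hx1 : x ∈ W.filter (· ∈ A) := by simp [hx, hA]
    have hx2 : x ∉ W.filter (· ∉ A) := by simp [hA]
    rw [Finset.filter_erase (· ∉ A), Finset.erase_eq_of_notMem hx2] at h1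
    have hc : (W.filter (· ∈ A)).card = ((W.erase x).filter (· ∈ A)).card + 1 := by
      rw [Finset.filter_erase, Finset.card_erase_add_one hx1]
    rw [hc, mul_add, mul_one] at hlt
    omega

end SumBound

section EvenCycle

theorem PathSeq.exists_isCycle {V : Type*} {G : SimpleGraph V} {k : ℕ} {W : Finset V} {v : ℕ → V}
    (h : PathSeq G W v (2 * k + 1)) (hk : 1 ≤ k) {u : V} (hu : u ∉ W) (h0 : G.Adj u (v 0))
    (h1 : G.Adj u (v (2 * k))) :
    ∃ (u : V) (c : G.Walk u u), c.IsCycle ∧ c.length = 2 * k + 2 := by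
  obtain ⟨w, hw, hl, hs⟩ := h.exists_walk
  have hus : u ∉ w.support := fun hm => by
    obtain ⟨i, hi, rfl⟩ := hs _ hm
    exact hu (h.mem i (by omega))
  refine ⟨u, .cons h0 (w.concat h1.symm), ?_, by simp [hl]⟩
  have hp : (w.concat h1.symm).IsPath := hw.concat hus _
  refine (SimpleGraph.Walk.cons_isCycle_iff _ _).mpr ⟨hp, fun hm => ?_⟩
  have := hp.length_eq_one_of_mem_edges (Sym2.eq_swap ▸ hm)
  simp only [SimpleGraph.Walk.length_concat] at this
  omega

variable {V : Type*} [Fintype V] {G : SimpleGraph V} [DecidableRel G.Adj] {k : ℕ}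

theorem sum_degree_neighborFinset_le (hk : 1 ≤ k)
    (hC : ¬ ∃ (u : V) (c : G.Walk u u), c.IsCycle ∧ c.length = 2 * k + 2) (u : V) :
    ∑ v ∈ G.neighborFinset u, G.degree v + k ≤ k * G.degree u + k * Fintype.card V := by
  classical
  let A := G.neighborFinset u
  let W : Finset V := Finset.univ.erase u
  let H : SimpleGraph V :=
    { Adj := fun x y => G.Adj x y ∧ (x ∈ A ∨ y ∈ A)
      symm := ⟨fun x y h => ⟨h.1.symm, h.2.symm⟩⟩
      loopless := ⟨fun x h => G.irrefl h.1⟩ }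
  have hA : ∀ x, x ∈ A ↔ G.Adj u x := fun x => G.mem_neighborFinset u x
  have key := sum_degIn_le (H := H) (A := A) hk (fun x y h => h.2) W fun v hv h0 h1 => by
    have hv' : PathSeq G W v (2 * k + 1) := ⟨hv.mem, hv.inj, fun i hi => (hv.adj i hi).1⟩
    exact hC (hv'.exists_isCycle hk (Finset.notMem_erase _ _) ((hA _).mp h0) ((hA _).mp h1))
  have hWA : W.filter (· ∈ A) = A := by
    ext x
    simp only [W, Finset.mem_filter, Finset.mem_erase, Finset.mem_univ, and_true, hA]
    exact ⟨fun h => h.2, fun h => ⟨h.ne', h⟩⟩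
  have hcA : A.card = G.degree u := rfl
  have hcW : (W.filter (· ∈ A)).card + (W.filter (· ∉ A)).card = W.card :=
    Finset.card_filter_add_card_filter_not _
  have hcW' : W.card + 1 = Fintype.card V := Finset.card_erase_add_one (Finset.mem_univ u)
  have hdeg : ∀ x ∈ A, G.degree x = degIn H W x + 1 := by
    intro x hx
    have hux : u ∈ G.neighborFinset x := by
      rw [G.mem_neighborFinset]
      exact ((hA x).mp hx).symm
    rw [← G.card_neighborFinset_eq_degree, ← Finset.card_erase_add_one hux]
    unfold degIn
    congr 2
    ext y
    simp only [W, H, Finset.mem_filter, Finset.mem_erase, Finset.mem_univ, and_true,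
      G.mem_neighborFinset, hx, true_or]
  rw [hWA] at key hcW
  rw [Finset.sum_congr rfl hdeg, Finset.sum_add_distrib, Finset.sum_const, smul_eq_mul, mul_one]
  obtain ⟨m, rfl⟩ : ∃ m, k = m + 1 := ⟨k - 1, by omega⟩
  rw [← hcW', ← hcW, ← hcA]
  rw [show 2 * (m + 1) - 1 = 2 * m + 1 by omega] at key
  change ∑ x ∈ A, degIn H W x + A.card + (m + 1) ≤ _
  nlinarith [key]

theorem sum_degree_sq_add_le (hk : 1 ≤ k)
    (hC : ¬ ∃ (u : V) (c : G.Walk u u), c.IsCycle ∧ c.length = 2 * k + 2) :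
    ∑ u, G.degree u ^ 2 + k * Fintype.card V ≤
      k * ∑ u, G.degree u + k * Fintype.card V ^ 2 := by
  have h := Finset.sum_le_sum fun u (_ : u ∈ Finset.univ) => sum_degree_neighborFinset_le hk hC u
  have hswap : ∑ u, ∑ v ∈ G.neighborFinset u, G.degree v = ∑ u, G.degree u ^ 2 := by
    rw [Finset.sum_comm' (t' := Finset.univ) (s' := fun v => G.neighborFinset v)
      (by simp [G.adj_comm])]
    simp [sq]
  simp only [Finset.sum_add_distrib, hswap, ← Finset.mul_sum, Finset.sum_const, Finset.card_univ,
    smul_eq_mul] at h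
  linarith [h]

theorem sum_degree_sq_le (hk : 1 ≤ k) (hkn : k ≤ Fintype.card V)
    (hC : ¬ ∃ (u : V) (c : G.Walk u u), c.IsCycle ∧ c.length = 2 * k + 2) :
    ∑ u, (G.degree u : ℝ) ^ 2 ≤ k * (Fintype.card V : ℝ) ^ 2
      + 2 * (k * Fintype.card V * √(k * Fintype.card V)) := by
  have h : ∑ u, (G.degree u : ℝ) ^ 2 + k * Fintype.card V ≤
      k * ∑ u, (G.degree u : ℝ) + k * (Fintype.card V : ℝ) ^ 2 := by
    exact_mod_cast sum_degree_sq_add_le hk hC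
  have hcs := sq_sum_le_card_mul_sum_sq (s := Finset.univ) (f := fun u => (G.degree u : ℝ))
  rw [Finset.card_univ] at hcs
  have hkn' : (k : ℝ) ≤ Fintype.card V := by exact_mod_cast hkn
  have hk' : (1 : ℝ) ≤ k := by exact_mod_cast hk
  set n := (Fintype.card V : ℝ)
  set S := ∑ u, (G.degree u : ℝ)
  set x := √(k * n) with hx
  have hx2 : x ^ 2 = k * n := Real.sq_sqrt (by positivity)
  have hkx : (k : ℝ) ≤ x := Real.le_sqrt_of_sq_le (by nlinarith)
  have hn : 1 ≤ n := hk'.trans hkn'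
  have hx0 : 0 < x := by linarith
  have hS : S ≤ 2 * (n * x) := by
    by_contra! hS
    have hnx : 0 < n * x := by positivity
    have h1 : S ^ 2 ≤ n * (k * S + k * n ^ 2) :=
      hcs.trans (mul_le_mul_of_nonneg_left (by nlinarith) (by linarith))
    have h2 : n * S * k ≤ n * S * x := mul_le_mul_of_nonneg_left hkx (by nlinarith)
    have h3 : n * (k * n ^ 2) = (n * x) ^ 2 := by
      rw [mul_pow, hx2]
      ring
    nlinarith
  nlinarith [mul_le_mul_of_nonneg_left hS (by linarith : (0 : ℝ) ≤ k)]

end EvenCycle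

/-- Corollary 3, explicit form. Let `k ≥ 1` be an integer, `p ≥ 2` a real
number, and let `G` be a graph with `n` vertices containing no cycle of length `2k+2`. Then
`∑_{u ∈ V(G)} d_G(u)^p ≤ k·n^p + 2(kn)^{3/2}·n^{p−2}`. -/
theorem degree_powers_stmt_3 {V : Type*} [Fintype V] [DecidableEq V]
    (G : SimpleGraph V) [DecidableRel G.Adj] (k : ℕ) (hk : 1 ≤ k)
    (p : ℝ) (hp : 2 ≤ p)
    (hC : ¬ ∃ (u : V) (c : G.Walk u u), c.IsCycle ∧ c.length = 2 * k + 2) :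
    ∑ u : V, (G.degree u : ℝ) ^ p
      ≤ k * (Fintype.card V : ℝ) ^ p
        + 2 * ((k : ℝ) * (Fintype.card V : ℝ)) ^ ((3 : ℝ) / 2)
          * (Fintype.card V : ℝ) ^ (p - 2) := by
  have hterm : ∀ u, (G.degree u : ℝ) ≤ Fintype.card V := fun u => by
    exact_mod_cast (G.degree_lt_card_verts u).le
  rcases lt_or_ge (Fintype.card V) k with hkn | hkn
  · have h1 : ∑ u : V, (G.degree u : ℝ) ^ p ≤ ∑ _u : V, (Fintype.card V : ℝ) ^ p :=
      Finset.sum_le_sum fun u _ =>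
        Real.rpow_le_rpow (Nat.cast_nonneg _) (hterm u) (by linarith)
    rw [Finset.sum_const, Finset.card_univ, nsmul_eq_mul] at h1
    have h2 : (Fintype.card V : ℝ) * (Fintype.card V : ℝ) ^ p ≤ k * (Fintype.card V : ℝ) ^ p :=
      mul_le_mul_of_nonneg_right (by exact_mod_cast hkn.le) (by positivity)
    have h3 : 0 ≤ 2 * ((k : ℝ) * (Fintype.card V : ℝ)) ^ ((3 : ℝ) / 2)
        * (Fintype.card V : ℝ) ^ (p - 2) := by positivity
    linarith
  · have hsplit : ∀ x : ℝ, 0 ≤ x → x ^ p = x ^ 2 * x ^ (p - 2) := fun x hx => by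
      rw [← Real.rpow_natCast, ← Real.rpow_add_of_nonneg hx (by norm_num) (by linarith)]
      norm_num
    have h32 : ((k : ℝ) * (Fintype.card V : ℝ)) ^ ((3 : ℝ) / 2)
        = k * Fintype.card V * √(k * Fintype.card V) := by
      rw [show (3 : ℝ) / 2 = 1 + 1 / 2 by norm_num,
        Real.rpow_add_of_nonneg (by positivity) (by norm_num) (by norm_num), Real.rpow_one,
        Real.sqrt_eq_rpow]
    rw [h32, hsplit _ (Nat.cast_nonneg _), ← mul_assoc, ← add_mul]
    refine le_trans ?_ (mul_le_mul_of_nonneg_right (sum_degree_sq_le hk hkn hC) (by positivity))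
    rw [Finset.sum_mul]
    refine Finset.sum_le_sum fun u _ => ?_
    rw [hsplit _ (Nat.cast_nonneg _)]
    exact mul_le_mul_of_nonneg_left
      (Real.rpow_le_rpow (Nat.cast_nonneg _) (hterm u) (by linarith)) (by positivity)
end
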